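/- arXiv:2408.11153 — 4 statements merged into one kernel-verified Lean document; each statement's English description precedes it below -/
import Mathlib

section
/- If the shift $B_{(T_k)}$ is chaotic on $\ell^p((X_k)_k,J)$ with $1\le p<\infty$ or on $c_0((X_k)_k,J)$ ($J=\mathbb{N}$ or $\mathbb{Z}$), then $B_{(T_k)}$ is frequently hypercyclic. -/
open Filter Topology ENNReal

section Defs
variable {Y : Type*} [TopologicalSpace Y]

/-- A map is hypercyclic if some point has dense orbit. -/
def Hypercyclic (f : Y → Y) : Prop := ∃ y : Y, Dense (Set.range fun n : ℕ => f^[n] y)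

/-- Topological transitivity. -/
def TopologicallyTransitive (f : Y → Y) : Prop :=
  ∀ U V : Set Y, IsOpen U → IsOpen V → U.Nonempty → V.Nonempty →
    ∃ n : ℕ, (f^[n] '' U ∩ V).Nonempty

/-- Topological mixing: return sets of pairs of non-empty open sets are cofinite. -/
def TopologicallyMixing (f : Y → Y) : Prop :=
  ∀ U V : Set Y, IsOpen U → IsOpen V → U.Nonempty → V.Nonempty →
    ∃ N : ℕ, ∀ n ≥ N, (f^[n] '' U ∩ V).Nonempty

/-- Weak mixing: `f ⊕ f` is hypercyclic. -/
def WeaklyMixing (f : Y → Y) : Prop := Hypercyclic (fun q : Y × Y => (f q.1, f q.2))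

/-- Chaos in the sense of Devaney: hypercyclic with a dense set of periodic points. -/
def Chaotic (f : Y → Y) : Prop :=
  Hypercyclic f ∧ Dense {y : Y | ∃ d : ℕ, 1 ≤ d ∧ f^[d] y = y}

/-- Lower density of a set of natural numbers. -/
noncomputable def lowerDensity (A : Set ℕ) : ℝ :=
  Filter.liminf
    (fun N : ℕ => (∑ n ∈ Finset.range N, Set.indicator A (fun _ => (1 : ℝ)) n) / N)
    Filter.atTop

/-- Frequent hypercyclicity: some orbit visits every non-empty open set along a set of
positive lower density. -/
def FrequentlyHypercyclic (f : Y → Y) : Prop :=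
  ∃ y : Y, ∀ U : Set Y, IsOpen U → U.Nonempty → 0 < lowerDensity {n : ℕ | f^[n] y ∈ U}

end Defs

/-- The `c₀`-sum of a family of normed spaces, realised as a submodule of `lp E ∞`:
those bounded families whose norms tend to `0` along the cofinite filter. -/
noncomputable def c0Sum {ι : Type*} (E : ι → Type*) [∀ i, NormedAddCommGroup (E i)]
    [∀ i, NormedSpace ℝ (E i)] : Submodule ℝ (lp E ∞) where
  carrier := {x | Tendsto (fun i => ‖(x : ∀ i, E i) i‖) cofinite (nhds 0)}
  add_mem' := by
    intro a b ha hb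
    refine squeeze_zero (fun i => norm_nonneg _) (fun i => ?_) (by simpa using ha.add hb)
    simp only [lp.coeFn_add, Pi.add_apply]
    exact norm_add_le _ _
  zero_mem' := by
    simp only [Set.mem_setOf_eq, lp.coeFn_zero, Pi.zero_apply, norm_zero]
    exact tendsto_const_nhds
  smul_mem' := by
    intro c a ha
    have h : Tendsto (fun i => ‖c‖ * ‖(a : ∀ i, E i) i‖) cofinite (nhds 0) := by
      simpa using ha.const_mul ‖c‖
    refine squeeze_zero (fun i => norm_nonneg _) (fun i => ?_) h
    simp only [lp.coeFn_smul, Pi.smul_apply]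
    exact (norm_smul c _).le

/-- The identity, as a continuous linear map between equal members of a family of spaces. -/
def castL (E : ℤ → Type*) [∀ k, NormedAddCommGroup (E k)] [∀ k, NormedSpace ℝ (E k)]
    {j k : ℤ} (h : j = k) : E j →L[ℝ] E k := by
  subst h; exact ContinuousLinearMap.id ℝ (E j)

/-- The composite `T_{j,j+n} = T_{j+1} ∘ ⋯ ∘ T_{j+n} : E (j+n) → E j` (here `T k` denotes
the operator `E (k+1) → E k`). -/
noncomputable def iterComp {E : ℤ → Type*} [∀ k, NormedAddCommGroup (E k)]
    [∀ k, NormedSpace ℝ (E k)] (T : ∀ k : ℤ, E (k + 1) →L[ℝ] E k) :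
    ∀ (j : ℤ) (n : ℕ), E (j + n) →L[ℝ] E j
  | j, 0 => castL E (by simp)
  | j, (n + 1) => (iterComp T j n).comp ((T (j + n)).comp (castL E (by push_cast; ring)))

theorem lowerDensity_pos_of_strictMono {A : Set ℕ} {g : ℕ → ℕ} (hg : StrictMono g)
    (hgA : ∀ j, g j ∈ A) {K : ℕ} (hK : 0 < K) (hgK : ∀ j, g j < K * (j + 1)) :
    0 < lowerDensity A := by
  have hK' : (0 : ℝ) < K := by exact_mod_cast hK
  have hcount : ∀ N : ℕ, ((N / K : ℕ) : ℝ) ≤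
      ∑ n ∈ Finset.range N, Set.indicator A (fun _ => (1 : ℝ)) n := by
    intro N
    have hsub : (Finset.range (N / K)).image g ⊆ Finset.range N := by
      intro n hn
      obtain ⟨j, hj, rfl⟩ := Finset.mem_image.1 hn
      have hj' : j + 1 ≤ N / K := Finset.mem_range.1 hj
      exact Finset.mem_range.2 ((hgK j).trans_le
        ((Nat.mul_le_mul_left K hj').trans (Nat.mul_div_le N K)))
    calc ((N / K : ℕ) : ℝ)
        = ∑ n ∈ (Finset.range (N / K)).image g, Set.indicator A (fun _ => (1 : ℝ)) n := by
          rw [Finset.sum_image hg.injective.injOn]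
          simp [hgA]
      _ ≤ _ := Finset.sum_le_sum_of_subset_of_nonneg hsub fun n _ _ =>
          Set.indicator_nonneg (fun _ _ => zero_le_one) n
  refine lt_of_lt_of_le (show (0 : ℝ) < 1 / (2 * K) by positivity)
    (le_liminf_of_le ?_ ?_)
  · refine IsCoboundedUnder.of_frequently_le (a := 1) (Eventually.frequently ?_)
    filter_upwards [eventually_gt_atTop 0] with N hN
    have hN' : (0 : ℝ) < N := by exact_mod_cast hN
    rw [div_le_one hN']
    calc _ ≤ ∑ n ∈ Finset.range N, (1 : ℝ) :=
          Finset.sum_le_sum fun n _ => Set.indicator_le_self' (fun _ _ => zero_le_one) n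
      _ = N := by simp
  · filter_upwards [eventually_ge_atTop (2 * K)] with N hN
    have hN' : (2 * K : ℝ) ≤ N := by exact_mod_cast hN
    have hfloor : (N : ℝ) < K * ((N / K : ℕ) + 1) := by
      exact_mod_cast Nat.lt_mul_div_succ N hK
    rw [div_le_div_iff₀ (by positivity) (by linarith)]
    nlinarith [hcount N]

theorem lowerDensity_mono {A A' : Set ℕ} (h : A ⊆ A') : lowerDensity A ≤ lowerDensity A' := by
  have hle : ∀ (D : Set ℕ) (N : ℕ),
      (∑ n ∈ Finset.range N, Set.indicator D (fun _ => (1 : ℝ)) n) / N ≤ 1 := by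
    intro D N
    refine div_le_one_of_le₀ ?_ N.cast_nonneg
    calc _ ≤ ∑ n ∈ Finset.range N, (1 : ℝ) :=
          Finset.sum_le_sum fun n _ => Set.indicator_le_self' (fun _ _ => zero_le_one) n
      _ = N := by simp
  refine liminf_le_liminf (Eventually.of_forall fun N => ?_) ?_ ?_
  · gcongr
  · exact isBoundedUnder_of ⟨0, fun N => div_nonneg (Finset.sum_nonneg fun n _ =>
      Set.indicator_nonneg (fun _ _ => zero_le_one) n) N.cast_nonneg⟩
  · exact IsCoboundedUnder.of_frequently_le (a := 1) (Frequently.of_forall (hle A'))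

/-- A sequence of integers whose `n`-th term is at distance more than `padicValNat 2 (n + 1)`
from all the others. -/
def spacedSeq (n : ℕ) : ℕ :=
  (padicValNat 2 (n + 1) + 1) + 2 * ∑ i ∈ Finset.range n, (padicValNat 2 (i + 1) + 1)

theorem spacedSeq_add_le {m n : ℕ} (h : m < n) :
    spacedSeq m + (padicValNat 2 (m + 1) + 1) + (padicValNat 2 (n + 1) + 1) ≤ spacedSeq n := by
  have : ∑ i ∈ Finset.range (m + 1), (padicValNat 2 (i + 1) + 1) ≤
      ∑ i ∈ Finset.range n, (padicValNat 2 (i + 1) + 1) :=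
    Finset.sum_le_sum_of_subset (Finset.range_subset_range.2 h)
  rw [Finset.sum_range_succ] at this
  unfold spacedSeq
  omega

theorem spacedSeq_strictMono : StrictMono spacedSeq := fun m n h => by
  have := spacedSeq_add_le h
  omega

theorem sum_padicValNat_succ (n : ℕ) :
    ∑ i ∈ Finset.range n, padicValNat 2 (i + 1) = padicValNat 2 n.factorial := by
  induction n with
  | zero => simp
  | succ n ih =>
    rw [Finset.sum_range_succ, ih, Nat.factorial_succ,
      padicValNat.mul n.succ_ne_zero n.factorial_ne_zero, add_comm]

theorem spacedSeq_lt (n : ℕ) : spacedSeq n < 4 * (n + 1) := by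
  have h : padicValNat 2 (n + 1).factorial ≤ n + 1 := by
    have := sub_one_mul_padicValNat_factorial (p := 2) (n + 1)
    omega
  rw [← sum_padicValNat_succ, Finset.sum_range_succ] at h
  unfold spacedSeq
  rw [Finset.sum_add_distrib]
  simp only [Finset.sum_const, Finset.card_range, smul_eq_mul, mul_one]
  omega

theorem exists_separated_sets (N : ℕ → ℕ) : ∃ A : ℕ → Set ℕ,
    (∀ k, 0 < lowerDensity (A k)) ∧ (∀ k, ∀ n ∈ A k, N k ≤ n) ∧
    ∀ k l, ∀ m ∈ A k, ∀ n ∈ A l, (k ≠ l ∨ m ≠ n) →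
      (N k : ℤ) ≤ |(n : ℤ) - m| ∧ (N l : ℤ) ≤ |(n : ℤ) - m| := by
  set a : ℕ → ℕ := fun k => ∑ i ∈ Finset.range (k + 1), (N i + 1) with ha
  have ha_mono : StrictMono a := strictMono_nat_of_lt_succ fun k => by
    simp only [ha, Finset.sum_range_succ _ (k + 1)]
    omega
  have haN : ∀ k, N k ≤ a k := fun k => by
    simp only [ha, Finset.sum_range_succ _ k]
    omega
  refine ⟨fun k => {m | ∃ n, padicValNat 2 (n + 1) = a k ∧ spacedSeq n = m}, fun k => ?_, ?_, ?_⟩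
  · have hpos : 0 < 2 ^ a k := by positivity
    refine lowerDensity_pos_of_strictMono (g := fun j => spacedSeq (2 ^ a k * (2 * j + 1) - 1))
      (K := 8 * 2 ^ a k) ?_ ?_ (by positivity) ?_
    · refine spacedSeq_strictMono.comp fun i j hij => ?_
      have h1 : 2 ^ a k * (2 * i + 1) < 2 ^ a k * (2 * j + 1) :=
        Nat.mul_lt_mul_of_pos_left (by omega) hpos
      have h2 : 0 < 2 ^ a k * (2 * i + 1) := by positivity
      omega
    · intro j
      refine ⟨_, ?_, rfl⟩
      rw [Nat.sub_add_cancel (Nat.succ_le_of_lt (by positivity)),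
        padicValNat.mul hpos.ne' (by omega), padicValNat.prime_pow,
        padicValNat.eq_zero_of_not_dvd (by omega), add_zero]
    · intro j
      have h2 : 0 < 2 ^ a k * (2 * j + 1) := by positivity
      refine (spacedSeq_lt _).trans_le ?_
      rw [Nat.sub_add_cancel h2]
      nlinarith
  · rintro k _ ⟨n, hn, rfl⟩
    have := haN k
    unfold spacedSeq
    omega
  · rintro k l _ ⟨i, hi, rfl⟩ _ ⟨j, hj, rfl⟩ hne
    have hk := haN k
    have hl := haN l
    have hij : i ≠ j := by
      rintro rfl
      rcases hne with h | h
      · exact h (ha_mono.injective (hi.symm.trans hj))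
      · exact h rfl
    rcases lt_or_gt_of_ne hij with h | h
    · have := spacedSeq_add_le h
      rw [abs_of_nonneg (by omega)]
      omega
    · have := spacedSeq_add_le h
      rw [abs_of_nonpos (by omega)]
      omega

theorem Summable.exists_norm_sum_le_of_forall_le_abs {Y : Type*} [NormedAddCommGroup Y]
    [CompleteSpace Y] {u : ℤ → Y} (hu : Summable u) {ε : ℝ} (hε : 0 < ε) :
    ∃ N : ℕ, ∀ F : Finset ℤ, (∀ n ∈ F, (N : ℤ) ≤ |n|) → ‖∑ n ∈ F, u n‖ ≤ ε := by
  obtain ⟨s, hs⟩ := summable_iff_vanishing_norm.1 hu ε hε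
  refine ⟨(s.sup Int.natAbs) + 1, fun F hF => (hs F ?_).le⟩
  refine Finset.disjoint_left.2 fun n hn hns => ?_
  have h1 := hF n hn
  rw [Int.abs_eq_natAbs] at h1
  have h2 : n.natAbs ≤ s.sup Int.natAbs := Finset.le_sup (f := Int.natAbs) hns
  omega

theorem norm_le_of_hasSum_of_norm_sum_le {ι Y : Type*} [NormedAddCommGroup Y] {v : ι → Y} {y : Y}
    (hv : HasSum v y) {ε : ℝ} (h : ∀ F : Finset ι, ‖∑ i ∈ F, v i‖ ≤ ε) : ‖y‖ ≤ ε :=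
  le_of_tendsto hv.norm (Eventually.of_forall h)

theorem norm_le_of_hasSum_indicator {Y : Type*} [NormedAddCommGroup Y] {u : ℤ → Y} {ε : ℝ} {N : ℕ}
    (hN : ∀ F : Finset ℤ, (∀ n ∈ F, (N : ℤ) ≤ |n|) → ‖∑ n ∈ F, u n‖ ≤ ε)
    {D : Set ℤ} (hD : ∀ n ∈ D, (N : ℤ) ≤ |n|) {y : Y} (hy : HasSum (D.indicator u) y) :
    ‖y‖ ≤ ε := by
  classical
  refine norm_le_of_hasSum_of_norm_sum_le hy fun F => ?_
  have : ∑ n ∈ F, D.indicator u n = ∑ n ∈ F with n ∈ D, u n := by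
    simp only [Set.indicator_apply, Finset.sum_filter]
  rw [this]
  exact hN _ fun n hn => hD n (Finset.mem_filter.1 hn).2

theorem exists_seq_infinitely_close {Y : Type*} [PseudoMetricSpace Y]
    [TopologicalSpace.SeparableSpace Y] [Nonempty Y] {s : Set Y} (hs : Dense s) :
    ∃ x : ℕ → Y, (∀ k, x k ∈ s) ∧ ∀ U : Set Y, IsOpen U → U.Nonempty →
      ∃ l, Metric.closedBall (x l) (2 * (1 / 2) ^ l) ⊆ U := by
  have : SecondCountableTopology Y := UniformSpace.secondCountable_of_separable Y
  obtain ⟨t, hts, htc, htd⟩ := hs.exists_countable_dense_subset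
  obtain ⟨z, rfl⟩ := htc.exists_eq_range htd.nonempty
  refine ⟨fun k => z k.unpair.1, fun k => hts ⟨_, rfl⟩, fun U hU hne => ?_⟩
  obtain ⟨_, hzU, i, rfl⟩ := htd.inter_open_nonempty U hU hne
  obtain ⟨r, hr, hrU⟩ := Metric.isOpen_iff.1 hU _ hzU
  obtain ⟨j, hj⟩ := exists_pow_lt_of_lt_one (half_pos hr) (show (1 / 2 : ℝ) < 1 by norm_num)
  refine ⟨Nat.pair i j, fun w hw => hrU ?_⟩
  simp only [Nat.unpair_pair, Metric.mem_closedBall] at hw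
  have : (1 / 2 : ℝ) ^ Nat.pair i j ≤ (1 / 2) ^ j :=
    pow_le_pow_of_le_one (by norm_num) (by norm_num) (Nat.right_le_pair i j)
  exact Metric.mem_ball.2 (by linarith)

/-- A form of the unconditional frequent hypercyclicity criterion: a dense set of points lying on
bi-infinite unconditionally summable orbits. -/
theorem frequentlyHypercyclic_of_dense_summable_orbits {Y : Type*} [NormedAddCommGroup Y]
    [NormedSpace ℝ Y] [CompleteSpace Y] [TopologicalSpace.SeparableSpace Y] (T : Y →L[ℝ] Y)
    (h : Dense {x : Y | ∃ u : ℤ → Y, u 0 = x ∧ (∀ n, T (u n) = u (n - 1)) ∧ Summable u}) :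
    FrequentlyHypercyclic ⇑T := by
  obtain ⟨x, hx, hxU⟩ := exists_seq_infinitely_close h
  choose u hu0 huT hus using hx
  have huiter : ∀ k (m : ℕ) n, T^[m] (u k n) = u k (n - m) := by
    intro k m
    induction m with
    | zero => simp
    | succ m ih =>
      intro n
      rw [Function.iterate_succ_apply', ih, huT]
      congr 1
      push_cast
      ring
  have hN : ∀ k : ℕ, ∃ N : ℕ, ∀ i ≤ k, ∀ F : Finset ℤ, (∀ n ∈ F, (N : ℤ) ≤ |n|) →
      ‖∑ n ∈ F, u i n‖ ≤ (1 / 2) ^ k * (1 / 2) ^ i := by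
    intro k
    choose N hN using fun i => (hus i).exists_norm_sum_le_of_forall_le_abs
      (show (0 : ℝ) < (1 / 2) ^ k * (1 / 2) ^ i by positivity)
    refine ⟨(Finset.range (k + 1)).sup N, fun i hi F hF => hN i F fun n hn => ?_⟩
    have h1 : N i ≤ (Finset.range (k + 1)).sup N :=
      Finset.le_sup (f := N) (Finset.mem_range.2 (by omega))
    have h2 := hF n hn
    omega
  choose N hN using hN
  obtain ⟨A, hAd, hAN, hAsep⟩ := exists_separated_sets N
  let D : ℕ → ℕ → Set ℤ := fun k m => {n | ∃ a ∈ A k, (a : ℤ) = n + m}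
  have hDs : ∀ k m, HasSum ((D k m).indicator (u k)) (∑' n, (D k m).indicator (u k) n) :=
    fun k m => ((hus k).indicator _).hasSum
  let y : ℕ → ℕ → Y := fun m k => ∑' n, (D k m).indicator (u k) n
  have hpow : ∀ m, ∃ S : Y →L[ℝ] Y, ⇑S = T^[m] := fun m =>
    ⟨T ^ m, FunLike.coe_pow_eq_iterate T m⟩
  have hyT : ∀ m k, T^[m] (y 0 k) = y m k := by
    intro m k
    obtain ⟨S, hS⟩ := hpow m
    have h1 : HasSum (fun n : ℤ => S ((D k 0).indicator (u k) (n + m))) (S (y 0 k)) :=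
      (Equiv.addRight (m : ℤ)).hasSum_iff.2 ((hDs k 0).mapL S)
    have h2 : (fun n : ℤ => S ((D k 0).indicator (u k) (n + m))) = (D k m).indicator (u k) := by
      funext n
      by_cases hn : n ∈ D k m
      · have hn' : n + m ∈ D k 0 := by simpa [D] using hn
        rw [Set.indicator_of_mem hn, Set.indicator_of_mem hn', hS, huiter, add_sub_cancel_right]
      · have hn' : n + m ∉ D k 0 := by simpa [D] using hn
        rw [Set.indicator_of_notMem hn, Set.indicator_of_notMem hn', map_zero]
    rw [h2, hS] at h1
    exact h1.unique (hDs k m)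
  have hgeom : HasSum (fun k : ℕ => (1 / 2 : ℝ) ^ k) 2 := hasSum_geometric_two
  have hy0 : Summable (y 0) := by
    refine Summable.of_norm_bounded hgeom.summable fun k => ?_
    refine (norm_le_of_hasSum_indicator (hN k k le_rfl) ?_ (hDs k 0)).trans
      (mul_le_of_le_one_right (by positivity) (pow_le_one₀ (by norm_num) (by norm_num)))
    rintro n ⟨a, ha, han⟩
    have := hAN k a ha
    rw [abs_of_nonneg (by omega)]
    omega
  have hyoff : ∀ l, ∀ m ∈ A l, ∀ k ≠ l, ‖y m k‖ ≤ (1 / 2) ^ l * (1 / 2) ^ k := by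
    intro l m hm k hkl
    have hsep : ∀ n ∈ D k m, (N k : ℤ) ≤ |n| ∧ (N l : ℤ) ≤ |n| := by
      rintro n ⟨a, ha, han⟩
      have := hAsep l k m hm a ha (Or.inl hkl.symm)
      rw [han, add_sub_cancel_right] at this
      exact this.symm
    rcases le_total k l with h | h
    · exact norm_le_of_hasSum_indicator (hN l k h) (fun n hn => (hsep n hn).2) (hDs k m)
    · refine (norm_le_of_hasSum_indicator (hN k k le_rfl) (fun n hn => (hsep n hn).1)
        (hDs k m)).trans ?_
      gcongr ?_ * _
      exact pow_le_pow_of_le_one (by norm_num) (by norm_num) h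
  have hydiag : ∀ l, ∀ m ∈ A l, ‖y m l - x l‖ ≤ (1 / 2) ^ l * (1 / 2) ^ l := by
    intro l m hm
    have h0 : (0 : ℤ) ∈ D l m := ⟨m, hm, by simp⟩
    have hs := (hDs l m).sub (hasSum_ite_eq (0 : ℤ) (x l))
    have heq : (fun n => (D l m).indicator (u l) n - if n = 0 then x l else 0) =
        (D l m \ {0}).indicator (u l) := by
      funext n
      by_cases hn : n = 0
      · subst hn
        simp [h0, hu0]
      · by_cases hD : n ∈ D l m <;> simp [hn, hD]
    rw [heq] at hs
    refine norm_le_of_hasSum_indicator (hN l l le_rfl) ?_ hs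
    rintro n ⟨⟨a, ha, han⟩, hn0⟩
    have hn0' : n ≠ 0 := hn0
    have := (hAsep l l m hm a ha (Or.inr (by omega))).1
    rwa [han, add_sub_cancel_right] at this
  have hmain : ∀ l, ∀ m ∈ A l, T^[m] (∑' k, y 0 k) ∈ Metric.closedBall (x l) (2 * (1 / 2) ^ l) := by
    intro l m hm
    have h1 : HasSum (y m) (T^[m] (∑' k, y 0 k)) := by
      obtain ⟨S, hS⟩ := hpow m
      simpa only [hS, hyT] using hy0.hasSum.mapL S
    have h2 := h1.sub (hasSum_ite_eq l (x l))
    rw [Metric.mem_closedBall, dist_eq_norm, mul_comm]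
    rw [← h2.tsum_eq]
    refine tsum_of_norm_bounded (hgeom.mul_left ((1 / 2) ^ l)) fun k => ?_
    by_cases hk : k = l
    · subst hk
      simpa using hydiag k m hm
    · simpa [hk] using hyoff l m hm k hk
  refine ⟨∑' k, y 0 k, fun U hU hne => ?_⟩
  obtain ⟨l, hl⟩ := hxU U hU hne
  exact (hAd l).trans_le (lowerDensity_mono fun m hm => hl (hmain l m hm))

/-- A chaotic operator which shifts the components of an unconditional decomposition indexed by
`ℤ` is frequently hypercyclic. -/
theorem Chaotic.frequentlyHypercyclic_of_shift {Y : Type*} [NormedAddCommGroup Y]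
    [NormedSpace ℝ Y] [CompleteSpace Y] (B : Y →L[ℝ] Y) (e : ℤ → Y → Y)
    (he : ∀ x, HasSum (fun k => e k x) x) (hB : ∀ k x, B (e k x) = e (k - 1) (B x))
    (hch : Chaotic ⇑B) : FrequentlyHypercyclic ⇑B := by
  obtain ⟨⟨y, hy⟩, hper⟩ := hch
  have : TopologicalSpace.SeparableSpace Y := ⟨⟨_, Set.countable_range _, hy⟩⟩
  refine frequentlyHypercyclic_of_dense_summable_orbits B (dense_closure.1 (hper.mono ?_))
  rintro x ⟨d, hd, hdx⟩
  refine mem_closure_of_tendsto (he x) (Eventually.of_forall fun F => ?_)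
  have hw : ∀ r, B^[r % d] x = B^[r] x := fun r =>
    Function.IsPeriodicPt.iterate_mod_apply (f := B) hdx r
  have hd0 : (0 : ℤ) < d := by exact_mod_cast hd
  let r : ℤ → ℕ := fun n => ((-n) % d).toNat
  have hrd : ∀ n, r n < d := fun n => by
    have := Int.emod_lt_of_pos (-n) hd0
    have := Int.emod_nonneg (-n) hd0.ne'
    simp only [r]
    omega
  have hrs : ∀ n, r (n - 1) = (r n + 1) % d := fun n => by
    have h1 := Int.emod_nonneg (-n) hd0.ne'
    have h2 := Int.emod_nonneg (-(n - 1)) hd0.ne'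
    zify
    simp only [r]
    rw [Int.toNat_of_nonneg h1, Int.toNat_of_nonneg h2, Int.emod_add_emod]
    congr 1
    ring
  refine ⟨fun n => ∑ i ∈ F, e (n + i) (B^[r n] x), ?_, fun n => ?_, ?_⟩
  · simp [r]
  · rw [map_sum]
    refine Finset.sum_congr rfl fun i _ => ?_
    rw [hB, hrs, hw, Function.iterate_succ_apply']
    congr 1
    ring
  · refine summable_sum fun i _ => ?_
    have hsum : Summable fun n => ∑ q ∈ Finset.range d,
        Set.indicator {n | r n = q} (fun n => e (n + i) (B^[q] x)) n :=
      summable_sum fun q _ =>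
        ((Equiv.addRight i).summable_iff.2 (he (B^[q] x)).summable).indicator _
    refine hsum.congr fun n => ?_
    rw [Finset.sum_eq_single (r n)]
    · simp
    · intro q _ hq
      refine Set.indicator_of_notMem ?_ _
      exact fun h : r n = q => hq h.symm
    · intro h
      exact absurd (Finset.mem_range.2 (hrd n)) h

theorem Chaotic.frequentlyHypercyclic_of_shift_nat {Y : Type*} [NormedAddCommGroup Y]
    [NormedSpace ℝ Y] [CompleteSpace Y] (B : Y →L[ℝ] Y) (e : ℕ → Y → Y)
    (he : ∀ x, HasSum (fun k => e k x) x) (hB0 : ∀ x, B (e 0 x) = 0)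
    (hB : ∀ k x, B (e (k + 1) x) = e k (B x))
    (hch : Chaotic ⇑B) : FrequentlyHypercyclic ⇑B := by
  let e' : ℤ → Y → Y := fun k x => if 0 ≤ k then e k.toNat x else 0
  have hneg : ∀ k < (0 : ℤ), ∀ x, e' k x = 0 := fun k hk x => if_neg hk.not_ge
  have hpos : ∀ (n : ℕ) x, e' n x = e n x := fun n x => by simp [e']
  refine hch.frequentlyHypercyclic_of_shift B e' (fun x => ?_) fun k x => ?_
  · refine (Function.Injective.hasSum_iff (g := ((↑) : ℕ → ℤ)) Nat.cast_injective
      fun k hk => hneg k ?_ x).1 ?_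
    · by_contra! h
      exact hk ⟨k.toNat, Int.toNat_of_nonneg h⟩
    · simpa only [Function.comp_def, hpos] using he x
  · rcases lt_or_ge k 0 with hk | hk
    · rw [hneg k hk, hneg (k - 1) (by omega), map_zero]
    · lift k to ℕ using hk
      rw [hpos]
      cases k with
      | zero => rw [hB0, hneg _ (by simp)]
      | succ k => rw [hB, Nat.cast_succ, add_sub_cancel_right, hpos]

section c0Sum

variable {ι : Type*} {E : ι → Type*} [∀ i, NormedAddCommGroup (E i)] [∀ i, NormedSpace ℝ (E i)]

theorem mem_c0Sum_iff {x : lp E ∞} :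
    x ∈ c0Sum E ↔ Tendsto (fun i => ‖(x : ∀ i, E i) i‖) cofinite (𝓝 0) := Iff.rfl

theorem isClosed_c0Sum : IsClosed (c0Sum E : Set (lp E ∞)) := by
  refine isClosed_of_closure_subset fun x hx => ?_
  refine Metric.tendsto_nhds.2 fun ε hε => ?_
  obtain ⟨z, hz, hxz⟩ := Metric.mem_closure_iff.1 hx (ε / 2) (half_pos hε)
  filter_upwards [Metric.tendsto_nhds.1 (mem_c0Sum_iff.1 hz) (ε / 2) (half_pos hε)] with i hi
  have h1 : ‖(x - z : lp E ∞) i‖ ≤ ‖x - z‖ := lp.norm_apply_le_norm (by simp) _ i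
  rw [dist_eq_norm] at hxz
  rw [Real.dist_0_eq_abs, abs_norm] at hi ⊢
  have h2 : ‖(x : ∀ i, E i) i‖ ≤ ‖(x - z : lp E ∞) i‖ + ‖(z : ∀ i, E i) i‖ := by
    rw [lp.coeFn_sub, Pi.sub_apply]
    exact norm_le_norm_sub_add _ _
  linarith

instance [∀ i, CompleteSpace (E i)] : CompleteSpace (c0Sum E) :=
  isClosed_c0Sum.completeSpace_coe

variable [DecidableEq ι]

/-- The element of the `c₀`-sum supported at `i` with value `a` there. -/
noncomputable def c0Sum.single (i : ι) (a : E i) : c0Sum E :=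
  ⟨lp.single ∞ i a, by
    refine mem_c0Sum_iff.2 (tendsto_const_nhds.congr' ?_)
    filter_upwards [(Set.finite_singleton i).compl_mem_cofinite] with j hj
    rw [lp.single_apply_ne _ _ _ hj, norm_zero]⟩

theorem c0Sum.hasSum_single (x : c0Sum E) :
    HasSum (fun i => c0Sum.single i ((x : lp E ∞) i)) x := by
  refine Metric.tendsto_nhds.2 fun ε hε => ?_
  have hfin : {i | ε / 2 ≤ ‖(x : lp E ∞) i‖}.Finite := by
    have := (mem_c0Sum_iff.1 x.2).eventually (gt_mem_nhds (half_pos hε))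
    simpa [Filter.eventually_cofinite] using this
  filter_upwards [eventually_ge_atTop hfin.toFinset] with s hs
  refine lt_of_le_of_lt ?_ (half_lt_self hε)
  rw [dist_eq_norm, ← Submodule.norm_coe]
  refine lp.norm_le_of_forall_le (half_pos hε).le fun j => ?_
  have hsum : (((∑ i ∈ s, c0Sum.single i ((x : lp E ∞) i) : c0Sum E) : lp E ∞) : ∀ i, E i) j =
      if j ∈ s then (x : lp E ∞) j else 0 := by
    rw [Submodule.coe_sum, lp.coeFn_sum, Finset.sum_apply]
    simp only [c0Sum.single, lp.single_apply]
    split_ifs with hj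
    · rw [Finset.sum_eq_single_of_mem j hj fun i _ hij => Pi.single_eq_of_ne hij.symm _,
        Pi.single_eq_same]
    · exact Finset.sum_eq_zero fun i hi =>
        Pi.single_eq_of_ne (fun h : j = i => hj (h ▸ hi)) _
  rw [Submodule.coe_sub, lp.coeFn_sub, Pi.sub_apply, hsum]
  split_ifs with hj
  · simpa using (half_pos hε).le
  · rw [zero_sub, norm_neg]
    by_contra! h
    exact hj (hs (hfin.mem_toFinset.2 h.le))

end c0Sum

/-- STATEMENT 11: if the shift `B_{(T_k)}` is chaotic on `ℓ^p((X_k)_k,J)` or on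
`c₀((X_k)_k,J)` (`J = ℕ` or `ℤ`), then it is frequently hypercyclic. -/
theorem stmt_12 (EN : ℕ → Type*) [∀ k, NormedAddCommGroup (EN k)] [∀ k, NormedSpace ℝ (EN k)]
    [∀ k, CompleteSpace (EN k)] (TN : ∀ k : ℕ, EN (k + 1) →L[ℝ] EN k)
    (EZ : ℤ → Type*) [∀ k, NormedAddCommGroup (EZ k)] [∀ k, NormedSpace ℝ (EZ k)]
    [∀ k, CompleteSpace (EZ k)] (TZ : ∀ k : ℤ, EZ (k + 1) →L[ℝ] EZ k)
    (p : ℝ≥0∞) [Fact (1 ≤ p)] (hp : p ≠ ∞) :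
    (∀ B : lp EN p →L[ℝ] lp EN p,
      (∀ (x : lp EN p) (k : ℕ), (B x : ∀ i, EN i) k = TN k ((x : ∀ i, EN i) (k + 1))) →
      Chaotic ⇑B → FrequentlyHypercyclic ⇑B)
    ∧ (∀ B : c0Sum EN →L[ℝ] c0Sum EN,
      (∀ (x : c0Sum EN) (k : ℕ),
        ((B x : lp EN ∞) : ∀ i, EN i) k = TN k (((x : lp EN ∞) : ∀ i, EN i) (k + 1))) →
      Chaotic ⇑B → FrequentlyHypercyclic ⇑B)
    ∧ (∀ B : lp EZ p →L[ℝ] lp EZ p,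
      (∀ (x : lp EZ p) (k : ℤ), (B x : ∀ i, EZ i) k = TZ k ((x : ∀ i, EZ i) (k + 1))) →
      Chaotic ⇑B → FrequentlyHypercyclic ⇑B)
    ∧ (∀ B : c0Sum EZ →L[ℝ] c0Sum EZ,
      (∀ (x : c0Sum EZ) (k : ℤ),
        ((B x : lp EZ ∞) : ∀ i, EZ i) k = TZ k (((x : lp EZ ∞) : ∀ i, EZ i) (k + 1))) →
      Chaotic ⇑B → FrequentlyHypercyclic ⇑B) := by
  refine ⟨fun B hB hch => ?_, fun B hB hch => ?_, fun B hB hch => ?_, fun B hB hch => ?_⟩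
  · refine hch.frequentlyHypercyclic_of_shift_nat B (fun k x => lp.single p k (x k))
      (fun x => lp.hasSum_single hp x) (fun x => ?_) fun k x => ?_
    · ext j
      rw [hB, lp.single_apply_ne _ _ _ (Nat.succ_ne_zero j), map_zero, lp.coeFn_zero, Pi.zero_apply]
    · ext j
      rw [hB]
      rcases eq_or_ne j k with rfl | hjk
      · rw [lp.single_apply_self, lp.single_apply_self, hB]
      · rw [lp.single_apply_ne _ _ _ hjk, lp.single_apply_ne _ _ _ (by omega), map_zero]
  · refine hch.frequentlyHypercyclic_of_shift_nat B
      (fun k x => c0Sum.single k ((x : lp EN ∞) k))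
      (fun x => c0Sum.hasSum_single x) (fun x => ?_) fun k x => ?_
    · ext j
      rw [hB, c0Sum.single, lp.single_apply_ne _ _ _ (Nat.succ_ne_zero j), map_zero]
      rfl
    · ext j
      rw [hB]
      simp only [c0Sum.single]
      rcases eq_or_ne j k with rfl | hjk
      · rw [lp.single_apply_self, lp.single_apply_self, hB]
      · rw [lp.single_apply_ne _ _ _ hjk, lp.single_apply_ne _ _ _ (by omega), map_zero]
  · refine hch.frequentlyHypercyclic_of_shift B (fun k x => lp.single p k (x k))
      (fun x => lp.hasSum_single hp x) fun k x => ?_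
    ext j
    rw [hB]
    obtain ⟨k, rfl⟩ : ∃ i, k = i + 1 := ⟨k - 1, by ring⟩
    rw [add_sub_cancel_right]
    rcases eq_or_ne j k with rfl | hjk
    · rw [lp.single_apply_self, lp.single_apply_self, hB]
    · rw [lp.single_apply_ne _ _ _ hjk, lp.single_apply_ne _ _ _ (by omega), map_zero]
  · refine hch.frequentlyHypercyclic_of_shift B
      (fun k x => c0Sum.single k ((x : lp EZ ∞) k))
      (fun x => c0Sum.hasSum_single x) fun k x => ?_
    ext j
    rw [hB]
    simp only [c0Sum.single]
    obtain ⟨k, rfl⟩ : ∃ i, k = i + 1 := ⟨k - 1, by ring⟩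
    rw [add_sub_cancel_right]
    rcases eq_or_ne j k with rfl | hjk
    · rw [lp.single_apply_self, lp.single_apply_self, hB]
    · rw [lp.single_apply_ne _ _ _ hjk, lp.single_apply_ne _ _ _ (by omega), map_zero]
end

section
/- Suppose the shift $B_{(T_k)}$ is frequently hypercyclic on $\ell^p((X_k)_k,\mathbb{Z})$ with $1\le p<\infty$. Then for every $k\in\mathbb{Z}$ and every non-empty open set $U_k\subseteq X_k$, both series $\sum_{n\ge1}\inf\{\|z\|_{k+n}^p : z\in X_{k+n},\ T_{k,k+n}z\in U_k\}$ and $\sum_{n\ge1}\inf\{\|z\|_{k-n}^p : z\in T_{k-n,k}(U_k)\}$ converge. -/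
open Filter Topology ENNReal

section Return

open Classical in
/-- The number of `n < N` satisfying `P`. -/
noncomputable def countBelow (P : ℕ → Prop) (N : ℕ) : ℕ := Nat.count P N

open Classical in
theorem countBelow_eq_sum (P : ℕ → Prop) (N : ℕ) :
    countBelow P N = ∑ n ∈ Finset.range N, if P n then 1 else 0 := by
  rw [countBelow, Nat.count_eq_card_filter_range, Finset.card_filter]

theorem countBelow_add (P : ℕ → Prop) (x N : ℕ) :
    countBelow P (x + N) = countBelow P x + countBelow (fun n => P (x + n)) N := by
  classical
  simp only [countBelow]
  convert Nat.count_add P x N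

theorem countBelow_mono (P : ℕ → Prop) {m n : ℕ} (h : m ≤ n) :
    countBelow P m ≤ countBelow P n := by
  classical exact Nat.count_monotone P h

theorem countBelow_le (P : ℕ → Prop) (n : ℕ) : countBelow P n ≤ n := by
  classical exact Nat.count_le _

theorem countBelow_le_shift_add (P : ℕ → Prop) (x N : ℕ) :
    countBelow P N ≤ countBelow (fun n => P (x + n)) N + x := by
  have h1 := countBelow_add P x N
  have h2 : countBelow P N ≤ countBelow P (x + N) := countBelow_mono P (by omega)
  have h3 := countBelow_le P x
  omega

theorem countBelow_shift_le_add (P : ℕ → Prop) (x N : ℕ) :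
    countBelow (fun n => P (x + n)) N ≤ countBelow P N + x := by
  have h1 := countBelow_add P x N
  have h2 := countBelow_add P N x
  have h3 := countBelow_le (fun k => P (N + k)) x
  rw [Nat.add_comm x N] at h1
  omega

open Classical in
theorem sum_count_shift_le (A : Set ℕ) (X : Finset ℕ) (N : ℕ) :
    ∑ x ∈ X, countBelow (fun n => x + n ∈ A) N ≤
      N + ∑ q ∈ X.offDiag, countBelow (fun n => q.1 + n ∈ A ∧ q.2 + n ∈ A) N := by
  simp only [countBelow_eq_sum]
  rw [Finset.sum_comm, Finset.sum_comm (s := X.offDiag)]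
  calc _ ≤ ∑ n ∈ Finset.range N,
        (1 + ∑ q ∈ X.offDiag, if q.1 + n ∈ A ∧ q.2 + n ∈ A then 1 else 0) := by
        refine Finset.sum_le_sum fun n _ => ?_
        rw [← Finset.card_filter, ← Finset.card_filter]
        have h : (X.filter fun x => x + n ∈ A).offDiag ⊆
            X.offDiag.filter fun q => q.1 + n ∈ A ∧ q.2 + n ∈ A := by
          intro q hq
          simp only [Finset.mem_offDiag, Finset.mem_filter] at hq ⊢
          tauto
        have h' := Finset.card_le_card h
        rw [Finset.offDiag_card] at h'
        set t := (X.filter fun x => x + n ∈ A).card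
        rcases Nat.lt_or_ge t 2 with ht | ht
        · omega
        · have : 2 * t ≤ t * t := Nat.mul_le_mul_right t ht
          omega
    _ = _ := by
        simp only [Finset.sum_add_distrib, Finset.sum_const, Finset.card_range, smul_eq_mul,
          mul_one]
        congr!

open Classical in
theorem exists_eventually_le_count_of_lowerDensity_pos {A : Set ℕ} (hA : 0 < lowerDensity A) :
    ∃ δ : ℝ, 0 < δ ∧ ∀ᶠ N : ℕ in atTop, δ * N ≤ countBelow (· ∈ A) N := by
  obtain ⟨δ, hδ, hlt⟩ := exists_between hA
  refine ⟨δ, hδ, ?_⟩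
  have hb : IsBoundedUnder (· ≥ ·) atTop
      (fun N : ℕ => (∑ n ∈ Finset.range N, Set.indicator A (fun _ => (1 : ℝ)) n) / N) :=
    isBoundedUnder_of ⟨0, fun N => div_nonneg
      (Finset.sum_nonneg fun n _ => Set.indicator_nonneg (fun _ _ => zero_le_one) n)
      (Nat.cast_nonneg N)⟩
  filter_upwards [eventually_lt_of_lt_liminf hlt hb, eventually_gt_atTop 0] with N hN hN0
  rw [lt_div_iff₀ (by exact_mod_cast hN0)] at hN
  refine hN.le.trans (le_of_eq ?_)
  rw [countBelow_eq_sum]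
  push_cast
  exact Finset.sum_congr rfl fun n _ => by simp [Set.indicator_apply]

/-- A set of positive lower density has a syndetic set of differences that occur
simultaneously with a uniform frequency. -/
theorem exists_syndetic_differences {A : Set ℕ} (hA : 0 < lowerDensity A) :
    ∃ (D : Set ℕ) (M : ℕ) (η : ℝ), 0 < η ∧ (∀ d, ∃ e ∈ D, d ≤ e ∧ e ≤ d + M) ∧
      ∀ F : Finset ℕ, (∀ d ∈ F, d ∈ D) → ∀ N₀ : ℕ, ∃ N ≥ N₀, ∀ d ∈ F,
        η * N ≤ countBelow (fun n => n ∈ A ∧ d + n ∈ A) N := by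
  obtain ⟨δ, hδ, hden⟩ := exists_eventually_le_count_of_lowerDensity_pos hA
  obtain ⟨r, hr⟩ := exists_nat_gt (3 / δ)
  rw [div_lt_iff₀ hδ] at hr
  have hr0 : (0 : ℝ) < r := by
    by_contra h
    nlinarith
  set η : ℝ := 1 / (r : ℝ) ^ 2 with hη
  have hη0 : 0 < η := by positivity
  have hle : (hyperfilter ℕ : Filter ℕ) ≤ atTop := Nat.hyperfilter_le_atTop
  set D : Set ℕ := {d | ∀ᶠ N : ℕ in (hyperfilter ℕ : Filter ℕ),
    η * N ≤ countBelow (fun n => n ∈ A ∧ d + n ∈ A) N} with hD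
  have hfin : ∀ F : Finset ℕ, (∀ d ∈ F, d ∈ D) → ∀ N₀ : ℕ, ∃ N ≥ N₀, ∀ d ∈ F,
      η * N ≤ countBelow (fun n => n ∈ A ∧ d + n ∈ A) N := by
    intro F hF N₀
    have h1 := (Finset.eventually_all F).2 hF
    exact (((eventually_ge_atTop N₀).filter_mono hle).and h1).exists
  by_cases hsyn : ∃ M, ∀ d, ∃ e ∈ D, d ≤ e ∧ e ≤ d + M
  · obtain ⟨M, hM⟩ := hsyn
    exact ⟨D, M, η, hη0, hM, hfin⟩
  exfalso
  push Not at hsyn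
  have hfam : ∀ s : ℕ, ∃ X : Finset ℕ, X.card = s ∧
      ∀ x ∈ X, ∀ y ∈ X, x < y → y - x ∉ D := by
    intro s
    induction s with
    | zero => exact ⟨∅, by simp⟩
    | succ s ih =>
      obtain ⟨X, hX, hXD⟩ := ih
      have hsup : ∀ x ∈ X, x ≤ X.sup id := fun x hx => Finset.le_sup (f := id) hx
      obtain ⟨d, hd⟩ := hsyn (X.sup id + 1)
      refine ⟨insert (d + X.sup id + 1) X, ?_, ?_⟩
      · rw [Finset.card_insert_of_notMem, hX]
        intro h
        have := hsup _ h
        omega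
      · intro x hx y hy hxy
        rw [Finset.mem_insert] at hx hy
        rcases hx with rfl | hx <;> rcases hy with rfl | hy
        · omega
        · have := hsup _ hy
          omega
        · intro h
          have h1 := hsup _ hx
          have := hd _ h (by omega)
          omega
        · exact hXD x hx y hy hxy
  obtain ⟨X, hX, hXD⟩ := hfam r
  set M := X.sup id
  have hsup : ∀ x ∈ X, x ≤ M := fun x hx => Finset.le_sup (f := id) hx
  have hpair : ∀ q ∈ X.offDiag, ∀ᶠ N : ℕ in (hyperfilter ℕ : Filter ℕ),
      (countBelow (fun n => q.1 + n ∈ A ∧ q.2 + n ∈ A) N : ℝ) ≤ η * N + M := by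
    have key : ∀ x ∈ X, ∀ y ∈ X, x < y → ∀ᶠ N : ℕ in (hyperfilter ℕ : Filter ℕ),
        (countBelow (fun n => x + n ∈ A ∧ y + n ∈ A) N : ℝ) ≤ η * N + M := by
      intro x hx y hy hxy
      have h := hXD x hx y hy hxy
      rw [hD, Set.mem_ofPred_eq, ← Ultrafilter.eventually_not] at h
      filter_upwards [h] with N hN
      rw [not_le] at hN
      have h1 := countBelow_shift_le_add (fun n => n ∈ A ∧ (y - x) + n ∈ A) x N
      have h2 : (fun n => x + n ∈ A ∧ (y - x) + (x + n) ∈ A) =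
          fun n => x + n ∈ A ∧ y + n ∈ A := by
        funext n
        rw [← Nat.add_assoc, Nat.sub_add_cancel hxy.le]
      simp only [h2] at h1
      have h3 : (countBelow (fun n => x + n ∈ A ∧ y + n ∈ A) N : ℝ) ≤
          countBelow (fun n => n ∈ A ∧ (y - x) + n ∈ A) N + x := by exact_mod_cast h1
      have h4 : (x : ℝ) ≤ M := by exact_mod_cast hsup x hx
      linarith
    rintro ⟨x, y⟩ hq
    obtain ⟨hx, hy, hne⟩ := Finset.mem_offDiag.1 hq
    rcases lt_or_gt_of_ne hne with h | h
    · exact key x hx y hy h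
    · filter_upwards [key y hy x hx h] with N hN
      simpa only [and_comm] using hN
  obtain ⟨N, ⟨hN1, hN2⟩, hN3⟩ := ((((Finset.eventually_all X.offDiag).2 hpair).and
    (hden.filter_mono hle)).and
    ((eventually_gt_atTop ((r + r ^ 2) * M)).filter_mono hle)).exists
  have hmain := sum_count_shift_le A X N
  have hlow : (r : ℝ) * (δ * N - M) ≤ ∑ x ∈ X, (countBelow (fun n => x + n ∈ A) N : ℝ) := by
    rw [← hX, ← nsmul_eq_mul]
    refine Finset.card_nsmul_le_sum _ _ _ fun x hx => ?_
    have h1 : (countBelow (· ∈ A) N : ℝ) ≤ countBelow (fun n => x + n ∈ A) N + x := by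
      exact_mod_cast countBelow_le_shift_add (· ∈ A) x N
    have h4 : (x : ℝ) ≤ M := by exact_mod_cast hsup x hx
    linarith
  have hup : ∑ q ∈ X.offDiag, (countBelow (fun n => q.1 + n ∈ A ∧ q.2 + n ∈ A) N : ℝ) ≤
      (r : ℝ) ^ 2 * (η * N + M) := by
    refine (Finset.sum_le_card_nsmul _ _ _ hN1).trans ?_
    rw [nsmul_eq_mul]
    refine mul_le_mul_of_nonneg_right ?_ (by positivity)
    rw [Finset.offDiag_card, hX]
    calc ((r * r - r : ℕ) : ℝ) ≤ ((r * r : ℕ) : ℝ) := by exact_mod_cast Nat.sub_le _ _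
      _ = (r : ℝ) ^ 2 := by push_cast; ring
  have hmain' : ∑ x ∈ X, (countBelow (fun n => x + n ∈ A) N : ℝ) ≤
      N + ∑ q ∈ X.offDiag, (countBelow (fun n => q.1 + n ∈ A ∧ q.2 + n ∈ A) N : ℝ) := by
    exact_mod_cast hmain
  have hN3' : ((r : ℝ) + r ^ 2) * M < N := by exact_mod_cast hN3
  have hηr : (r : ℝ) ^ 2 * (η * N + M) = N + r ^ 2 * M := by
    rw [hη]
    field_simp
  have hrN : 3 * (N : ℝ) ≤ r * δ * N := mul_le_mul_of_nonneg_right hr.le (Nat.cast_nonneg N)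
  nlinarith

open Classical in
theorem sum_mul_count_le (a : ℕ → ℝ≥0∞) (Q : ℕ → ℕ → Prop) (F : Finset ℕ) (R : ℝ≥0∞)
    (h : ∀ n, ∀ G : Finset ℕ, (∀ d ∈ G, Q d n) → ∑ d ∈ G, a d ≤ R) (N : ℕ) :
    ∑ d ∈ F, a d * (countBelow (Q d) N : ℝ≥0∞) ≤ N * R := by
  simp only [countBelow_eq_sum, Nat.cast_sum, Finset.mul_sum]
  rw [Finset.sum_comm]
  calc _ ≤ ∑ n ∈ Finset.range N, R := by
        refine Finset.sum_le_sum fun n _ => ?_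
        refine le_trans (le_of_eq ?_)
          (h n (F.filter fun d => Q d n) fun d hd => (Finset.mem_filter.1 hd).2)
        rw [Finset.sum_filter]
        exact Finset.sum_congr rfl fun d _ => by split_ifs <;> simp
    _ = _ := by simp

open Classical in
theorem tsum_indicator_ne_top {A D : Set ℕ} {η : ℝ} (hη : 0 < η)
    (hD : ∀ F : Finset ℕ, (∀ d ∈ F, d ∈ D) → ∀ N₀ : ℕ, ∃ N ≥ N₀, ∀ d ∈ F,
      η * N ≤ countBelow (fun n => n ∈ A ∧ d + n ∈ A) N)
    {a : ℕ → ℝ≥0∞} {R : ℝ≥0∞} (hR : R ≠ ∞)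
    (h : ∀ F : Finset ℕ, ∃ M : ℕ, ∀ N : ℕ,
      ∑ d ∈ F, a d * (countBelow (fun n => n ∈ A ∧ d + n ∈ A) N : ℝ≥0∞) ≤
        ((M + N : ℕ) : ℝ≥0∞) * R) :
    ∑' d, D.indicator a d ≠ ∞ := by
  have hη' : ENNReal.ofReal η ≠ 0 := by simpa using hη
  have hbound : ∑' d, D.indicator a d ≤ 2 * R / ENNReal.ofReal η := by
    rw [ENNReal.tsum_eq_iSup_sum]
    refine iSup_le fun s => ?_
    obtain ⟨M, hM⟩ := h (s.filter (· ∈ D))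
    obtain ⟨N, hN, hcount⟩ := hD (s.filter (· ∈ D)) (fun d hd => (Finset.mem_filter.1 hd).2)
      (M + 1)
    have hN0 : (N : ℝ≥0∞) ≠ 0 := by
      simp only [ne_eq, Nat.cast_eq_zero]
      omega
    have hsum : ∑ d ∈ s, D.indicator a d = ∑ d ∈ s.filter (· ∈ D), a d := by
      rw [Finset.sum_filter]
      exact Finset.sum_congr rfl fun d _ => by simp [Set.indicator_apply]
    rw [hsum, ENNReal.le_div_iff_mul_le (Or.inl hη') (Or.inl ENNReal.ofReal_ne_top)]
    rw [← ENNReal.mul_le_mul_iff_left hN0 (ENNReal.natCast_ne_top N)]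
    calc (∑ d ∈ s.filter (· ∈ D), a d) * ENNReal.ofReal η * N
        = ∑ d ∈ s.filter (· ∈ D), a d * (ENNReal.ofReal η * N) := by
          rw [mul_assoc, Finset.sum_mul]
      _ ≤ ∑ d ∈ s.filter (· ∈ D),
          a d * (countBelow (fun n => n ∈ A ∧ d + n ∈ A) N : ℝ≥0∞) := by
          refine Finset.sum_le_sum fun d hd => mul_le_mul_right ?_ _
          rw [← ENNReal.ofReal_natCast, ← ENNReal.ofReal_natCast, ← ENNReal.ofReal_mul hη.le]
          exact ENNReal.ofReal_le_ofReal (hcount d hd)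
      _ ≤ ((M + N : ℕ) : ℝ≥0∞) * R := hM N
      _ ≤ ((2 * N : ℕ) : ℝ≥0∞) * R := by
          refine mul_le_mul_left ?_ _
          exact_mod_cast (by omega : M + N ≤ 2 * N)
      _ = 2 * R * N := by
          push_cast
          ring
  exact ne_top_of_le_ne_top (ENNReal.div_ne_top (ENNReal.mul_ne_top (by simp) hR) hη') hbound

theorem tsum_mul_sum_shift_ne_top {g : ℕ → ℝ≥0∞} (hg : ∑' d, g d ≠ ∞) {K : ℝ≥0∞} (hK : K ≠ ∞)
    (M : ℕ) : ∑' d, K * ∑ j ∈ Finset.range M, g (d + j) ≠ ∞ := by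
  rw [ENNReal.tsum_mul_left, Summable.tsum_finsetSum fun _ _ => ENNReal.summable]
  refine ENNReal.mul_ne_top hK (ENNReal.sum_ne_top.2 fun j _ => ?_)
  exact ne_top_of_le_ne_top hg
    (ENNReal.tsum_comp_le_tsum_of_injective (add_left_injective j) g)

theorem le_pow_mul_of_le_mul_succ {a : ℕ → ℝ≥0∞} {C : ℝ≥0∞} (h : ∀ n, a n ≤ C * a (n + 1))
    (n j : ℕ) : a n ≤ C ^ j * a (n + j) := by
  induction j with
  | zero => simp
  | succ j ih =>
    refine ih.trans ?_
    rw [pow_succ, mul_assoc]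
    exact mul_le_mul_right (h (n + j)) _

theorem le_pow_mul_of_succ_le_mul {a : ℕ → ℝ≥0∞} {C : ℝ≥0∞} (h : ∀ n, a (n + 1) ≤ C * a n)
    (n j : ℕ) : a (n + j) ≤ C ^ j * a n := by
  induction j with
  | zero => simp
  | succ j ih =>
    rw [pow_succ', mul_assoc]
    exact (h (n + j)).trans (mul_le_mul_right ih _)

theorem le_sum_range_indicator {D : Set ℕ} {M d e : ℕ} (a : ℕ → ℝ≥0∞) (he : e ∈ D) (hde : d ≤ e)
    (hed : e ≤ d + M) : a e ≤ ∑ j ∈ Finset.range (M + 1), D.indicator a (d + j) := by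
  have h := Finset.single_le_sum (f := fun j => D.indicator a (d + j)) (fun _ _ => zero_le)
    (Finset.mem_range.2 (by omega : e - d < M + 1))
  simpa [Nat.add_sub_cancel' hde, he] using h

/-- The Bayart–Ruzsa lemma, for sequences that decrease at most geometrically. -/
theorem tsum_ne_top_of_forward_differences {A : Set ℕ} (hA : 0 < lowerDensity A)
    {a : ℕ → ℝ≥0∞} {C R : ℝ≥0∞} (hC : C ≠ ∞) (hR : R ≠ ∞) (ha : ∀ n, a n ≤ C * a (n + 1))
    (h : ∀ n ∈ A, ∀ F : Finset ℕ, (∀ d ∈ F, d + n ∈ A) → ∑ d ∈ F, a d ≤ R) :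
    ∑' n, a n ≠ ∞ := by
  obtain ⟨D, M, η, hη, hsyn, hD⟩ := exists_syndetic_differences hA
  have hfin : ∑' d, D.indicator a d ≠ ∞ := by
    refine tsum_indicator_ne_top hη hD hR fun F => ⟨0, fun N => ?_⟩
    rw [Nat.zero_add]
    refine sum_mul_count_le a (fun d n => n ∈ A ∧ d + n ∈ A) F R (fun n G hG => ?_) N
    rcases G.eq_empty_or_nonempty with rfl | ⟨d, hd⟩
    · simp
    · exact h n (hG d hd).1 G fun e he => (hG e he).2
  have ha' : ∀ n, a n ≤ max 1 C * a (n + 1) := fun n =>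
    (ha n).trans (mul_le_mul_left (le_max_right _ _) _)
  refine ne_top_of_le_ne_top (tsum_mul_sum_shift_ne_top hfin
    (ENNReal.pow_ne_top (n := M) (max_lt ENNReal.one_lt_top hC.lt_top).ne) (M + 1))
    (ENNReal.tsum_le_tsum fun d => ?_)
  obtain ⟨e, heD, hde, hed⟩ := hsyn d
  have h1 := le_pow_mul_of_le_mul_succ ha' d (e - d)
  rw [Nat.add_sub_cancel' hde] at h1
  exact h1.trans (mul_le_mul' (pow_le_pow_right₀ (le_max_left _ _) (by omega))
    (le_sum_range_indicator a heD hde hed))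

/-- The Bayart–Ruzsa lemma, for sequences that grow at most geometrically. -/
theorem tsum_ne_top_of_backward_differences {A : Set ℕ} (hA : 0 < lowerDensity A)
    {a : ℕ → ℝ≥0∞} {C R : ℝ≥0∞} (hC : C ≠ ∞) (hR : R ≠ ∞) (hfin : ∀ n, a n ≠ ∞)
    (ha : ∀ n, a (n + 1) ≤ C * a n)
    (h : ∀ n ∈ A, ∀ F : Finset ℕ, (∀ d ∈ F, ∃ m ∈ A, d + m = n) → ∑ d ∈ F, a d ≤ R) :
    ∑' n, a n ≠ ∞ := by
  obtain ⟨D, M, η, hη, hsyn, hD⟩ := exists_syndetic_differences hA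
  have hind : ∑' d, D.indicator a d ≠ ∞ := by
    refine tsum_indicator_ne_top hη hD hR fun F => ⟨F.sup id, fun N => ?_⟩
    refine le_trans (Finset.sum_le_sum fun d hd => mul_le_mul_right (Nat.cast_le.2 ?_) _)
      (sum_mul_count_le a (fun d n => n ∈ A ∧ ∃ m ∈ A, d + m = n) F R (fun n G hG => ?_)
        (F.sup id + N))
    · have h1 := countBelow_add (fun n => n ∈ A ∧ ∃ m ∈ A, d + m = n) d N
      have h2 : countBelow (fun n => n ∈ A ∧ ∃ m ∈ A, d + m = n) (d + N) ≤
          countBelow (fun n => n ∈ A ∧ ∃ m ∈ A, d + m = n) (F.sup id + N) :=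
        countBelow_mono _ (Nat.add_le_add_right (Finset.le_sup (f := id) hd) N)
      have h3 : (fun n => d + n ∈ A ∧ ∃ m ∈ A, d + m = d + n) =
          fun n => n ∈ A ∧ d + n ∈ A := by
        funext n
        simp [and_comm]
      simp only [h3] at h1
      omega
    · rcases G.eq_empty_or_nonempty with rfl | ⟨d, hd⟩
      · simp
      · exact h n (hG d hd).1 G fun e he => (hG e he).2
  have ha' : ∀ n, a (n + 1) ≤ max 1 C * a n := fun n =>
    (ha n).trans (mul_le_mul_left (le_max_right _ _) _)
  rw [← ENNReal.summable.sum_add_tsum_nat_add' (k := M)]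
  refine ENNReal.add_ne_top.2 ⟨ENNReal.sum_ne_top.2 fun n _ => hfin n, ?_⟩
  refine ne_top_of_le_ne_top (tsum_mul_sum_shift_ne_top hind
    (ENNReal.pow_ne_top (n := M) (max_lt ENNReal.one_lt_top hC.lt_top).ne) (M + 1))
    (ENNReal.tsum_le_tsum fun d => ?_)
  obtain ⟨e, heD, hde, hed⟩ := hsyn d
  have h1 := le_pow_mul_of_succ_le_mul ha' e (d + M - e)
  rw [Nat.add_sub_cancel' hed] at h1
  exact h1.trans (mul_le_mul' (pow_le_pow_right₀ (le_max_left _ _) (by omega))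
    (le_sum_range_indicator a heD hde hed))

end Return

section Shift

variable {E : ℤ → Type*} [∀ k, NormedAddCommGroup (E k)] {p : ℝ≥0∞} [Fact (1 ≤ p)]

theorem sum_nnnorm_rpow_le (hp : p ≠ ∞) (x : lp E p) (s : Finset ℤ) :
    ∑ i ∈ s, (‖(x : ∀ i, E i) i‖₊ : ℝ≥0∞) ^ p.toReal ≤ (‖x‖₊ : ℝ≥0∞) ^ p.toReal := by
  have hp0 : 0 < p.toReal := ENNReal.toReal_pos (zero_lt_one.trans_le Fact.out).ne' hp
  have h := lp.sum_rpow_le_norm_rpow hp0 x s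
  simp only [← ENNReal.coe_rpow_of_nonneg _ hp0.le]
  rw [← ENNReal.ofNNReal_finsetSum, ENNReal.coe_le_coe, ← NNReal.coe_le_coe]
  push_cast
  exact h

theorem sum_nnnorm_rpow_comp_le (hp : p ≠ ∞) (x : lp E p) (F : Finset ℕ) {f : ℕ → ℤ}
    (hf : Function.Injective f) :
    ∑ d ∈ F, (‖(x : ∀ i, E i) (f d)‖₊ : ℝ≥0∞) ^ p.toReal ≤ (‖x‖₊ : ℝ≥0∞) ^ p.toReal := by
  have h := sum_nnnorm_rpow_le hp x (F.map ⟨f, hf⟩)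
  rwa [Finset.sum_map] at h

variable [∀ k, NormedSpace ℝ (E k)]

theorem castL_apply_family (x : ∀ i, E i) {i j : ℤ} (h : i = j) : castL E h (x i) = x j := by
  subst h
  rfl

theorem nnnorm_castL {i j : ℤ} (h : i = j) (z : E i) : ‖castL E h z‖₊ = ‖z‖₊ := by
  subst h
  rfl

variable {T : ∀ k : ℤ, E (k + 1) →L[ℝ] E k} {B : lp E p →L[ℝ] lp E p}

theorem shift_iterate_apply
    (hB : ∀ (x : lp E p) (k : ℤ), (B x : ∀ i, E i) k = T k ((x : ∀ i, E i) (k + 1)))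
    (n : ℕ) (x : lp E p) (j : ℤ) :
    (B^[n] x : ∀ i, E i) j = iterComp T j n ((x : ∀ i, E i) (j + n)) := by
  induction n generalizing x with
  | zero => exact (castL_apply_family (fun i => x i) (by simp)).symm
  | succ n ih =>
    rw [Function.iterate_succ_apply, ih, hB]
    simp only [iterComp, ContinuousLinearMap.comp_apply]
    rw [castL_apply_family (fun i => x i)]

theorem nnnorm_apply_le_of_shift
    (hB : ∀ (x : lp E p) (k : ℤ), (B x : ∀ i, E i) k = T k ((x : ∀ i, E i) (k + 1)))
    (k : ℤ) (v : E (k + 1)) : ‖T k v‖₊ ≤ ‖B‖₊ * ‖v‖₊ := by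
  have hp0 : 0 < p := zero_lt_one.trans_le Fact.out
  have h1 : (B (lp.single p (k + 1) v) : ∀ i, E i) k = T k v := by
    rw [hB, lp.single_apply_self]
  have h2 := lp.norm_apply_le_norm hp0.ne' (B (lp.single p (k + 1) v)) k
  have h3 := B.le_opNorm (lp.single p (k + 1) v)
  rw [lp.norm_single hp0] at h3
  rw [h1] at h2
  exact h2.trans h3

end Shift

/-- if the bilateral shift `B_{(T_k)}` is frequently hypercyclic on
`ℓ^p((X_k)_k,ℤ)`, then for every `k` and non-empty open `U ⊆ X_k`, the series
`∑_{n≥1} inf{‖z‖^p : T_{k,k+n} z ∈ U}` and `∑_{n≥1} inf{‖T_{k-n,k} z‖^p : z ∈ U}` converge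
(infima taken in `[0,∞]`, so finiteness of the sums expresses the convergence). -/
theorem stmt_13 (E : ℤ → Type*) [∀ k, NormedAddCommGroup (E k)] [∀ k, NormedSpace ℝ (E k)]
    [∀ k, CompleteSpace (E k)] (T : ∀ k : ℤ, E (k + 1) →L[ℝ] E k)
    (p : ℝ≥0∞) [Fact (1 ≤ p)] (hp : p ≠ ∞)
    (B : lp E p →L[ℝ] lp E p)
    (hB : ∀ (x : lp E p) (k : ℤ), (B x : ∀ i, E i) k = T k ((x : ∀ i, E i) (k + 1)))
    (hFH : FrequentlyHypercyclic ⇑B) :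
    ∀ (k : ℤ) (U : Set (E k)), IsOpen U → U.Nonempty →
      ((∑' n : ℕ, ⨅ (z : E (k + ((n + 1 : ℕ) : ℤ))) (_ : iterComp T k (n + 1) z ∈ U),
          ((‖z‖₊ : ℝ≥0∞) ^ p.toReal)) ≠ ∞)
      ∧ ((∑' n : ℕ, ⨅ z ∈ U,
          ((‖((iterComp T (k - ((n + 1 : ℕ) : ℤ)) (n + 1)).comp (castL E (by omega))) z‖₊
            : ℝ≥0∞) ^ p.toReal)) ≠ ∞) := by
  intro k U hU hUne
  obtain ⟨y, hy⟩ := hFH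
  have hp1 : 1 ≤ p := Fact.out
  have hp0 : 0 < p := zero_lt_one.trans_le hp1
  obtain ⟨u, hu⟩ := hUne
  set r : NNReal := ‖u‖₊ + 1 with hr
  set W : Set (lp E p) := {x | (x : ∀ i, E i) k ∈ U} ∩ {x | ‖x‖ < r} with hW
  have hWo : IsOpen W :=
    (hU.preimage (lp.lipschitzWith_one_eval p k).continuous).inter
      (isOpen_lt continuous_norm continuous_const)
  have hWne : W.Nonempty := by
    refine ⟨lp.single p k u, ?_, ?_⟩
    · simpa [lp.single_apply_self] using hu
    · simp [lp.norm_single hp0, hr]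
  have hA := hy W hWo hWne
  have hrp : (r : ℝ≥0∞) ^ p.toReal ≠ ∞ :=
    ENNReal.rpow_ne_top_of_nonneg ENNReal.toReal_nonneg ENNReal.coe_ne_top
  set C : ℝ≥0∞ := (‖B‖₊ : ℝ≥0∞) ^ p.toReal + 1 with hC
  have hC0 : C ≠ 0 := by simp [hC]
  have hCtop : C ≠ ∞ := ENNReal.add_ne_top.2
    ⟨ENNReal.rpow_ne_top_of_nonneg ENNReal.toReal_nonneg ENNReal.coe_ne_top, ENNReal.one_ne_top⟩
  have hnorm : ∀ n, B^[n] y ∈ W → (‖B^[n] y‖₊ : ℝ≥0∞) ^ p.toReal ≤ (r : ℝ≥0∞) ^ p.toReal :=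
    fun n hn => ENNReal.rpow_le_rpow (ENNReal.coe_le_coe.2 (le_of_lt hn.2))
      ENNReal.toReal_nonneg
  have hT : ∀ (j : ℤ) (v : E (j + 1)), (‖T j v‖₊ : ℝ≥0∞) ^ p.toReal ≤
      C * (‖v‖₊ : ℝ≥0∞) ^ p.toReal := by
    intro j v
    refine le_trans ?_ (mul_le_mul_left le_self_add _)
    rw [← ENNReal.mul_rpow_of_nonneg _ _ ENNReal.toReal_nonneg]
    refine ENNReal.rpow_le_rpow ?_ ENNReal.toReal_nonneg
    exact_mod_cast nnnorm_apply_le_of_shift hB j v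
  constructor
  · set a : ℕ → ℝ≥0∞ := fun n => ⨅ (z : E (k + (n : ℤ))) (_ : iterComp T k n z ∈ U),
      ((‖z‖₊ : ℝ≥0∞) ^ p.toReal) with ha
    refine ne_top_of_le_ne_top (b := ∑' n, a n) ?_
      (ENNReal.tsum_comp_le_tsum_of_injective (add_left_injective 1) a)
    refine tsum_ne_top_of_forward_differences hA hCtop hrp (fun n => ?_) fun n hn F hF => ?_
    · simp only [ha, ENNReal.mul_iInf_of_ne hC0 hCtop]
      refine le_iInf₂ fun z hz => ?_
      simp only [iterComp, ContinuousLinearMap.comp_apply] at hz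
      refine (iInf₂_le (T (k + n) (castL E (by push_cast; ring) z)) hz).trans
        ((hT _ _).trans (le_of_eq ?_))
      rw [nnnorm_castL]
    · refine le_trans (Finset.sum_le_sum fun d hd => ?_)
        ((sum_nnnorm_rpow_comp_le hp (B^[n] y) F
          (f := fun d : ℕ => k + (d : ℤ)) fun d e hde => by simpa using hde).trans (hnorm n hn))
      refine iInf₂_le (B^[n] y (k + (d : ℤ))) ?_
      rw [← shift_iterate_apply hB, ← Function.iterate_add_apply]
      exact (hF d hd).1
  · set a : ℕ → ℝ≥0∞ := fun n => ⨅ z ∈ U,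
      ((‖((iterComp T (k - (n : ℤ)) n).comp (castL E (by omega))) z‖₊
        : ℝ≥0∞) ^ p.toReal) with ha
    have hsingle : ∀ (x : lp E p) (n : ℕ), ((iterComp T (k - (n : ℤ)) n).comp
        (castL E (by omega))) ((x : ∀ i, E i) k) = (B^[n] x : ∀ i, E i) (k - n) := by
      intro x n
      rw [shift_iterate_apply hB, ContinuousLinearMap.comp_apply,
        castL_apply_family (fun i => x i)]
    refine ne_top_of_le_ne_top (b := ∑' n, a n) ?_
      (ENNReal.tsum_comp_le_tsum_of_injective (add_left_injective 1) a)
    refine tsum_ne_top_of_backward_differences hA hCtop hrp (fun n => ?_) (fun n => ?_)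
      fun n hn F hF => ?_
    · refine ne_top_of_le_ne_top ?_ (iInf₂_le u hu)
      exact ENNReal.rpow_ne_top_of_nonneg ENNReal.toReal_nonneg ENNReal.coe_ne_top
    · simp only [ha, ENNReal.mul_iInf_of_ne hC0 hCtop]
      refine le_iInf₂ fun z hz => ?_
      refine (iInf₂_le z hz).trans ?_
      obtain ⟨x, rfl⟩ : ∃ x : lp E p, (x : ∀ i, E i) k = z :=
        ⟨lp.single p k z, lp.single_apply_self ..⟩
      rw [hsingle, hsingle, Function.iterate_succ_apply', hB]
      refine (hT _ _).trans (le_of_eq ?_)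
      rw [show k - ((n + 1 : ℕ) : ℤ) + 1 = k - n by push_cast; ring]
    · refine le_trans (Finset.sum_le_sum fun d hd => ?_)
        ((sum_nnnorm_rpow_comp_le hp (B^[n] y) F
          (f := fun d : ℕ => k - (d : ℤ)) fun d e hde => by simpa using hde).trans (hnorm n hn))
      obtain ⟨m, hm, rfl⟩ := hF d hd
      refine (iInf₂_le (B^[m] y k) hm.1).trans (le_of_eq ?_)
      rw [hsingle, ← Function.iterate_add_apply]
end

section
/- If the shift $B_{(T_k)}$ is frequently hypercyclic on $\ell^p((X_k)_k,J)$ with $1\le p<\infty$ ($J=\mathbb{N}$ or $\mathbb{Z}$), then $B_{(T_k)}$ is mixing. -/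
open Filter Topology ENNReal

/-- The Cesàro mean of `f` along the hyperfilter on `ℕ`. -/
noncomputable def cesaroMean (f : ℕ → ℝ) : ℝ :=
  limUnder (hyperfilter ℕ : Filter ℕ) fun N : ℕ => (∑ n ∈ Finset.range N, f n) / N

theorem tendsto_cesaroMean {f : ℕ → ℝ} {C : ℝ} (hf : ∀ n, |f n| ≤ C) :
    Tendsto (fun N : ℕ => (∑ n ∈ Finset.range N, f n) / N) (hyperfilter ℕ : Filter ℕ)
      (𝓝 (cesaroMean f)) := by
  have hC : 0 ≤ C := (abs_nonneg _).trans (hf 0)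
  have hmem : ∀ N : ℕ, (∑ n ∈ Finset.range N, f n) / N ∈ Set.Icc (-C) C := by
    intro N
    rw [Set.mem_Icc, ← abs_le, abs_div, Nat.abs_cast]
    refine div_le_of_le_mul₀ (Nat.cast_nonneg N) hC ?_
    calc |∑ n ∈ Finset.range N, f n| ≤ ∑ n ∈ Finset.range N, |f n| :=
          Finset.abs_sum_le_sum_abs _ _
      _ ≤ ∑ _n ∈ Finset.range N, C := Finset.sum_le_sum fun n _ => hf n
      _ = C * N := by simp [mul_comm]
  obtain ⟨x, -, hx⟩ := (isCompact_Icc (a := -C) (b := C)).ultrafilter_le_nhds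
    ((hyperfilter ℕ).map fun N : ℕ => (∑ n ∈ Finset.range N, f n) / N)
    (le_principal_iff.2 (Ultrafilter.mem_map.2 (univ_mem' hmem)))
  exact tendsto_nhds_limUnder ⟨x, hx⟩

theorem cesaroMean_mono {f g : ℕ → ℝ} {C D : ℝ} (hf : ∀ n, |f n| ≤ C) (hg : ∀ n, |g n| ≤ D)
    (hfg : ∀ n, f n ≤ g n) : cesaroMean f ≤ cesaroMean g :=
  le_of_tendsto_of_tendsto' (tendsto_cesaroMean hf) (tendsto_cesaroMean hg) fun N =>
    div_le_div_of_nonneg_right (Finset.sum_le_sum fun n _ => hfg n) (Nat.cast_nonneg N)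

theorem cesaroMean_const (c : ℝ) : cesaroMean (fun _ => c) = c := by
  refine tendsto_nhds_unique (tendsto_cesaroMean (C := |c|) fun _ => le_rfl) ?_
  refine Tendsto.mono_left ?_ Nat.hyperfilter_le_atTop
  refine tendsto_const_nhds.congr' ?_
  filter_upwards [eventually_gt_atTop 0] with N hN
  have : (N : ℝ) ≠ 0 := by positivity
  simp; field_simp

theorem cesaroMean_finset_sum {ι : Type*} (s : Finset ι) {f : ι → ℕ → ℝ} {C : ℝ}
    (hf : ∀ i n, |f i n| ≤ C) :
    cesaroMean (fun n => ∑ i ∈ s, f i n) = ∑ i ∈ s, cesaroMean (f i) := by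
  have hb : ∀ n, |∑ i ∈ s, f i n| ≤ ∑ _i ∈ s, C := fun n =>
    (Finset.abs_sum_le_sum_abs _ _).trans (Finset.sum_le_sum fun i _ => hf i n)
  refine tendsto_nhds_unique (tendsto_cesaroMean hb) ?_
  refine (tendsto_finsetSum s fun i _ => tendsto_cesaroMean (hf i)).congr fun N => ?_
  rw [← Finset.sum_div, Finset.sum_comm]

theorem cesaroMean_succ {f : ℕ → ℝ} {C : ℝ} (hf : ∀ n, |f n| ≤ C) :
    cesaroMean (fun n => f (n + 1)) = cesaroMean f := by
  refine tendsto_nhds_unique (tendsto_cesaroMean (C := C) fun n => hf (n + 1)) ?_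
  have h0 : Tendsto (fun N : ℕ => (f N - f 0) / N) atTop (𝓝 0) := by
    refine squeeze_zero_norm (fun N => ?_)
      (tendsto_const_nhds.div_atTop tendsto_natCast_atTop_atTop : Tendsto
        (fun N : ℕ => (C + C) / (N : ℝ)) atTop (𝓝 0))
    rw [norm_div, Real.norm_eq_abs, Real.norm_natCast]
    gcongr
    exact (abs_sub _ _).trans (add_le_add (hf N) (hf 0))
  have h := (tendsto_cesaroMean hf).add (h0.mono_left Nat.hyperfilter_le_atTop)
  rw [add_zero] at h
  refine h.congr fun N => ?_
  rw [← add_div]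
  congr 1
  have h1 := Finset.sum_range_succ f N
  have h2 := Finset.sum_range_succ' f N
  linarith

theorem cesaroMean_add_right {f : ℕ → ℝ} {C : ℝ} (hf : ∀ n, |f n| ≤ C) (k : ℕ) :
    cesaroMean (fun n => f (n + k)) = cesaroMean f := by
  induction k with
  | zero => rfl
  | succ k ih =>
    rw [← ih, ← cesaroMean_succ (f := fun n => f (n + k)) (C := C) fun n => hf _]
    exact congrArg cesaroMean (funext fun n => by rw [add_right_comm, add_assoc])

theorem cesaroMean_indicator_pos {A : Set ℕ} (hA : 0 < lowerDensity A) :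
    0 < cesaroMean (A.indicator fun _ => 1) := by
  have hb : ∀ n, |A.indicator (fun _ => (1 : ℝ)) n| ≤ 1 := fun n => by
    by_cases h : n ∈ A <;> simp [h]
  obtain ⟨c, hc0, hc⟩ := exists_between hA
  have hev := eventually_lt_of_lt_liminf hc (isBoundedUnder_of ⟨0, fun N =>
    div_nonneg (Finset.sum_nonneg fun n _ => Set.indicator_nonneg (fun _ _ => zero_le_one) n)
      (Nat.cast_nonneg N)⟩)
  exact hc0.trans_le (ge_of_tendsto (tendsto_cesaroMean hb)
    ((hev.filter_mono Nat.hyperfilter_le_atTop).mono fun N hN => hN.le))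

/-- Translates of a set of positive lower density overlap, with mean bounded below, along a
syndetic set of shifts. -/
theorem exists_syndetic_cesaroMean {A : Set ℕ} (hA : 0 < lowerDensity A) {e : ℕ → ℝ}
    (he : e = A.indicator fun _ => 1) :
    ∃ δ > 0, ∃ g : ℕ, ∀ k, ∃ s, k ≤ s ∧ s ≤ k + g ∧
      δ ≤ cesaroMean fun n => e n * e (n + s) := by
  have he0 : ∀ n, e n = 0 ∨ e n = 1 := fun n => by
    by_cases h : n ∈ A <;> simp [he, h]
  have heb : ∀ n, |e n| ≤ 1 := fun n => by rcases he0 n with h | h <;> simp [h]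
  have heb2 : ∀ a b n, |e (n + a) * e (n + b)| ≤ 1 := fun a b n => by
    rw [abs_mul]; exact mul_le_one₀ (heb _) (abs_nonneg _) (heb _)
  have hc : 0 < cesaroMean e := he ▸ cesaroMean_indicator_pos hA
  set c := cesaroMean e
  obtain ⟨S, hS⟩ := exists_nat_gt (3 / c)
  rw [div_lt_iff₀ hc] at hS
  have hS0 : (0 : ℝ) < S := by
    by_contra! h
    nlinarith
  set q : ℕ → ℕ → ℝ := fun a b => cesaroMean fun n => e (n + a) * e (n + b) with hq
  have hsymm : ∀ a b, q a b = q b a := fun a b => by simp only [hq, mul_comm]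
  set δ : ℝ := 1 / S ^ 2
  have hδ : 0 < δ := by positivity
  have hcard : ∀ F : Finset ℕ, (∀ a ∈ F, ∀ b ∈ F, a ≠ b → q a b < δ) → F.card ≠ S := by
    intro F hF hFS
    have hsum : cesaroMean (fun n => ∑ a ∈ F, e (n + a)) = S * c := by
      rw [cesaroMean_finset_sum F (C := 1) fun a n => heb _]
      simp [cesaroMean_add_right heb, hFS, c]
    have hoff : cesaroMean (fun n => ∑ x ∈ F.offDiag, e (n + x.1) * e (n + x.2)) ≤ 1 := by
      rw [cesaroMean_finset_sum F.offDiag (f := fun (x : ℕ × ℕ) n => e (n + x.1) * e (n + x.2))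
        (C := 1) fun a n => heb2 _ _ _]
      calc ∑ x ∈ F.offDiag, q x.1 x.2 ≤ ∑ _x ∈ F.offDiag, δ :=
            Finset.sum_le_sum fun x hx => by
              rw [Finset.mem_offDiag] at hx
              exact (hF _ hx.1 _ hx.2.1 hx.2.2).le
        _ = F.offDiag.card * δ := by simp
        _ ≤ (S : ℝ) ^ 2 * δ := by
            gcongr
            rw [Finset.offDiag_card, hFS]
            exact_mod_cast (Nat.sub_le _ _).trans_eq (sq S).symm
        _ = 1 := by simp only [δ]; field_simp
    have hpt : ∀ n, 2 * ∑ a ∈ F, e (n + a) - 1 ≤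
        ∑ a ∈ F, e (n + a) + ∑ x ∈ F.offDiag, e (n + x.1) * e (n + x.2) := by
      intro n
      have h1 : (∑ a ∈ F, e (n + a)) * ∑ a ∈ F, e (n + a) =
          ∑ a ∈ F, e (n + a) + ∑ x ∈ F.offDiag, e (n + x.1) * e (n + x.2) := by
        rw [Finset.sum_mul_sum, ← Finset.sum_product', ← Finset.diag_union_offDiag,
          Finset.sum_union (Finset.disjoint_diag_offDiag F), Finset.sum_diag]
        congr 1
        refine Finset.sum_congr rfl fun a _ => ?_
        rcases he0 (n + a) with h | h <;> simp [h]
      nlinarith [sq_nonneg (∑ a ∈ F, e (n + a) - 1)]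
    have hb1 : ∀ n, |∑ a ∈ F, e (n + a)| ≤ ∑ _a ∈ F, (1 : ℝ) := fun n =>
      (Finset.abs_sum_le_sum_abs _ _).trans (Finset.sum_le_sum fun i _ => heb _)
    have hb2 : ∀ n, |∑ x ∈ F.offDiag, e (n + x.1) * e (n + x.2)| ≤ ∑ _a ∈ F.offDiag, (1 : ℝ) :=
      fun n => (Finset.abs_sum_le_sum_abs _ _).trans (Finset.sum_le_sum fun i _ => heb2 _ _ _)
    have hlim : S * c ≤ 1 + 1 := by
      have h1 := tendsto_cesaroMean hb1
      have h2 := tendsto_cesaroMean hb2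
      have h3 := tendsto_cesaroMean (f := fun _ => 1) (C := 1) (by simp)
      rw [cesaroMean_const] at h3
      rw [hsum] at h1
      refine (le_of_tendsto_of_tendsto' h1 (h3.add h2) fun N => ?_).trans (by linarith)
      rw [← add_div, ← Finset.sum_add_distrib]
      refine div_le_div_of_nonneg_right (Finset.sum_le_sum fun n _ => ?_) (Nat.cast_nonneg N)
      linarith [hpt n]
    linarith
  obtain ⟨F, hF, hmax⟩ : ∃ F : Finset ℕ, (∀ a ∈ F, ∀ b ∈ F, a ≠ b → q a b < δ) ∧
      ∀ K ∉ F, ∃ a ∈ F, δ ≤ q a K := by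
    by_contra! hno
    have hall : ∀ m, ∃ F : Finset ℕ, (∀ a ∈ F, ∀ b ∈ F, a ≠ b → q a b < δ) ∧ F.card = m := by
      intro m
      induction m with
      | zero => exact ⟨∅, by simp, rfl⟩
      | succ m ih =>
        obtain ⟨F, hF, hFm⟩ := ih
        obtain ⟨K, hK, hKF⟩ := hno F hF
        refine ⟨insert K F, ?_, by rw [Finset.card_insert_of_notMem hK, hFm]⟩
        intro a ha b hb hab
        rcases Finset.mem_insert.1 ha with rfl | ha' <;>
          rcases Finset.mem_insert.1 hb with rfl | hb'
        · exact absurd rfl hab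
        · rw [hsymm]; exact hKF b hb'
        · exact hKF a ha'
        · exact hF a ha' b hb' hab
    obtain ⟨F, hF, hFS⟩ := hall S
    exact hcard F hF hFS
  refine ⟨δ, hδ, F.sup id + 1, fun k => ?_⟩
  have hle : ∀ a ∈ F, a ≤ F.sup id := fun a ha => Finset.le_sup (f := id) ha
  obtain ⟨a, ha, hak⟩ := hmax (k + (F.sup id + 1)) fun h => by
    have := hle _ h
    omega
  have := hle a ha
  refine ⟨k + (F.sup id + 1) - a, by omega, by omega, ?_⟩
  rw [← cesaroMean_add_right (f := fun n => e n * e (n + (k + (F.sup id + 1) - a)))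
    (fun n => heb2 0 _ n) a]
  convert hak using 4 with n
  congr 1
  omega

/-- A set `A` of positive lower density has, for a syndetic set of shifts, arbitrarily many
coincidences `n, n + k ∈ A` and `n - k, n ∈ A` at a single point `n ∈ A`. -/
theorem exists_syndetic_coincidences {A : Set ℕ} (hA : 0 < lowerDensity A) :
    ∃ (g : ℕ) (S : Set ℕ), (∀ k, ∃ s ∈ S, k ≤ s ∧ s ≤ k + g) ∧
      ∀ K ⊆ S, K.Infinite → ∀ C : ℝ,
        (∃ n ∈ A, ∃ F : Finset ℕ, ↑F ⊆ K ∧ C < F.card ∧ ∀ k ∈ F, n + k ∈ A) ∧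
        (∃ n ∈ A, ∃ F : Finset ℕ, ↑F ⊆ K ∧ C < F.card ∧ ∀ k ∈ F, ∃ m ∈ A, m + k = n) := by
  classical
  obtain ⟨δ, hδ, g, hg⟩ := exists_syndetic_cesaroMean hA rfl
  set e : ℕ → ℝ := A.indicator fun _ => 1 with he
  have heb : ∀ n, |e n| ≤ 1 := fun n => by by_cases h : n ∈ A <;> simp [he, h]
  have heb2 : ∀ a b, |e a * e b| ≤ 1 := fun a b => by
    rw [abs_mul]; exact mul_le_one₀ (heb _) (abs_nonneg _) (heb _)
  refine ⟨g, {s | δ ≤ cesaroMean fun n => e n * e (n + s)}, fun k => ?_, fun K hKS hK C => ?_⟩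
  · obtain ⟨s, h1, h2, h3⟩ := hg k
    exact ⟨s, h3, h1, h2⟩
  have hcount : ∀ (P : ℕ → Prop) [DecidablePred P] (F : Finset ℕ),
      ∑ k ∈ F, (if P k then (1 : ℝ) else 0) = (F.filter P).card := fun P _ F => by
    simp
  obtain ⟨L, hL⟩ := exists_nat_gt (max C 0 / δ)
  rw [div_lt_iff₀ hδ] at hL
  obtain ⟨F, hFK, hFL⟩ := hK.exists_subset_card_eq L
  have key : ∀ f : ℕ → ℕ → ℝ, (∀ k n, |f k n| ≤ 1) → (∀ k ∈ F, δ ≤ cesaroMean (f k)) →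
      ∃ n, max C 0 < ∑ k ∈ F, f k n := by
    intro f hf hfδ
    by_contra! hno
    have h1 : cesaroMean (fun n => ∑ k ∈ F, f k n) ≤ cesaroMean fun _ => max C 0 :=
      cesaroMean_mono (fun n => (Finset.abs_sum_le_sum_abs _ _).trans
        (Finset.sum_le_sum fun k _ => hf k n)) (fun _ => le_rfl) hno
    rw [cesaroMean_const, cesaroMean_finset_sum F hf] at h1
    have h2 : ∑ _k ∈ F, δ ≤ ∑ k ∈ F, cesaroMean (f k) := Finset.sum_le_sum hfδ
    rw [Finset.sum_const, hFL, nsmul_eq_mul] at h2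
    linarith
  have extract : ∀ (P : ℕ → Prop) (n : ℕ) (f : ℕ → ℝ),
      (∀ k, f k = if n ∈ A ∧ P k then 1 else 0) → max C 0 < ∑ k ∈ F, f k →
      n ∈ A ∧ ∃ F' : Finset ℕ, ↑F' ⊆ K ∧ C < F'.card ∧ ∀ k ∈ F', P k := by
    intro P n f hf hlt
    simp only [hf, hcount] at hlt
    have hpos : 0 < (F.filter fun k => n ∈ A ∧ P k).card := by
      exact_mod_cast (le_max_right C 0).trans_lt hlt
    obtain ⟨k, hk⟩ := Finset.card_pos.1 hpos
    refine ⟨(Finset.mem_filter.1 hk).2.1, F.filter fun k => n ∈ A ∧ P k, fun k hk => ?_,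
      (le_max_left C 0).trans_lt hlt, fun k hk => (Finset.mem_filter.1 hk).2.2⟩
    exact hFK (Finset.mem_filter.1 hk).1
  constructor
  · obtain ⟨n, hn⟩ := key (fun k n => e n * e (n + k)) (fun k n => heb2 _ _)
      fun k hk => hKS (hFK hk)
    refine ⟨n, extract (fun k => n + k ∈ A) n _ (fun k => ?_) hn⟩
    by_cases h : n ∈ A <;> by_cases h' : n + k ∈ A <;> simp [he, h, h']
  · have hb : ∀ k n, |if k ≤ n then e (n - k) * e n else 0| ≤ 1 := fun k n => by
      split_ifs
      · exact heb2 _ _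
      · simp
    obtain ⟨n, hn⟩ := key (fun k n => if k ≤ n then e (n - k) * e n else 0) hb
      fun k hk => by
        rw [← cesaroMean_add_right (hb k) k]
        simpa using hKS (hFK hk)
    refine ⟨n, extract (fun k => ∃ m ∈ A, m + k = n) n _ (fun k => ?_) hn⟩
    by_cases hkn : k ≤ n
    · have hiff : (∃ m ∈ A, m + k = n) ↔ n - k ∈ A := by
        constructor
        · rintro ⟨m, hm, rfl⟩
          simpa using hm
        · exact fun h => ⟨n - k, h, by omega⟩
      simp only [hkn, if_true, hiff]
      by_cases h : n ∈ A <;> by_cases h' : n - k ∈ A <;> simp [he, h, h']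
    · have : ¬ ∃ m ∈ A, m + k = n := by
        rintro ⟨m, -, rfl⟩
        omega
      simp [hkn, this]

/-- A bounded operator is mixing as soon as, for all large `n`, every vector can be perturbed to
have a small image under `B ^ n` and is approximated by the image of a small vector. -/
theorem topologicallyMixing_of_forall {X : Type*} [NormedAddCommGroup X] [NormedSpace ℝ X]
    (B : X →L[ℝ] X)
    (hback : ∀ x : X, ∀ ε > 0, ∃ N : ℕ, ∀ n ≥ N, ∃ u, ‖u - x‖ < ε ∧ ‖(B ^ n) u‖ < ε)
    (hfwd : ∀ x : X, ∀ ε > 0, ∃ N : ℕ, ∀ n ≥ N, ∃ z, ‖z‖ < ε ∧ ‖(B ^ n) z - x‖ < ε) :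
    TopologicallyMixing ⇑B := by
  rintro U V hU hV ⟨u, hu⟩ ⟨v, hv⟩
  obtain ⟨ε, hε, hεU⟩ := Metric.isOpen_iff.1 hU u hu
  obtain ⟨η, hη, hηV⟩ := Metric.isOpen_iff.1 hV v hv
  have hr : 0 < min ε η / 2 := half_pos (lt_min hε hη)
  obtain ⟨N₁, h₁⟩ := hback u _ hr
  obtain ⟨N₂, h₂⟩ := hfwd v _ hr
  refine ⟨max N₁ N₂, fun n hn => ?_⟩
  obtain ⟨u', hu', hBu'⟩ := h₁ n (le_of_max_le_left hn)
  obtain ⟨z, hz, hBz⟩ := h₂ n (le_of_max_le_right hn)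
  refine ⟨B^[n] (u' + z), ⟨u' + z, hεU ?_, rfl⟩, hηV ?_⟩
  · rw [mem_ball_iff_norm, add_sub_right_comm]
    linarith [norm_add_le (u' - u) z, min_le_left ε η]
  · rw [mem_ball_iff_norm, ← FunLike.coe_pow_eq_iterate, map_add, add_sub_assoc]
    linarith [norm_add_le ((B ^ n) u') ((B ^ n) z - v), min_le_right ε η]

/-- A property of vectors that is approximable, additive and true at `0` and at every `single`
holds on all of `ℓ^p`. -/
theorem lp_induction_of_approx {ι : Type*} [DecidableEq ι] {E : ι → Type*}
    [∀ i, NormedAddCommGroup (E i)] {p : ℝ≥0∞} [Fact (1 ≤ p)] (hp : p ≠ ∞)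
    {P : lp E p → ℝ → Prop}
    (happrox : ∀ x ε, 0 < ε → (∃ y, ‖y - x‖ < ε / 2 ∧ P y (ε / 2)) → P x ε)
    (hadd : ∀ x y ε, P x (ε / 2) → P y (ε / 2) → P (x + y) ε)
    (hzero : ∀ ε > 0, P 0 ε) (hsingle : ∀ i u, ∀ ε > 0, P (lp.single p i u) ε)
    (x : lp E p) {ε : ℝ} (hε : 0 < ε) : P x ε := by
  have hsum : ∀ s : Finset ι, ∀ ε > 0, P (∑ i ∈ s, lp.single p i (x i)) ε := by
    intro s
    induction s using Finset.induction_on with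
    | empty => simpa using hzero
    | insert i s hi ih =>
      intro ε hε
      rw [Finset.sum_insert hi]
      exact hadd _ _ _ (hsingle _ _ _ (half_pos hε)) (ih _ (half_pos hε))
  obtain ⟨s, hs⟩ := ((lp.hasSum_single hp x).eventually
    (Metric.ball_mem_nhds x (half_pos hε))).exists
  exact happrox x ε hε ⟨_, mem_ball_iff_norm.1 hs, hsum s _ (half_pos hε)⟩

theorem lp_card_le_of_forall_le_norm {ι : Type*} {E : ι → Type*} [∀ i, NormedAddCommGroup (E i)]
    {p : ℝ≥0∞} [Fact (1 ≤ p)] (hp : 0 < p.toReal) (f : lp E p) {F : Finset ℕ} {idx : ℕ → ι}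
    (hidx : Set.InjOn idx F) {ε R : ℝ} (hε : 0 < ε) (hf : ∀ k ∈ F, ε ≤ ‖f (idx k)‖)
    (hR : ‖f‖ ≤ R) : (F.card : ℝ) ≤ (R / ε) ^ p.toReal := by
  classical
  have hR0 : 0 ≤ R := (norm_nonneg f).trans hR
  rw [Real.div_rpow hR0 hε.le, le_div_iff₀ (Real.rpow_pos_of_pos hε _)]
  calc (F.card : ℝ) * ε ^ p.toReal = ∑ _k ∈ F, ε ^ p.toReal := by simp
    _ ≤ ∑ k ∈ F, ‖f (idx k)‖ ^ p.toReal :=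
        Finset.sum_le_sum fun k hk => Real.rpow_le_rpow hε.le (hf k hk) hp.le
    _ = ∑ i ∈ F.image idx, ‖f i‖ ^ p.toReal := by rw [Finset.sum_image hidx]
    _ ≤ ‖f‖ ^ p.toReal := lp.sum_rpow_le_norm_rpow hp f _
    _ ≤ R ^ p.toReal := Real.rpow_le_rpow (norm_nonneg f) hR hp.le

theorem norm_pow_apply_le {X : Type*} [NormedAddCommGroup X] [NormedSpace ℝ X] (B : X →L[ℝ] X)
    {n g : ℕ} (hn : n ≤ g) (x : X) : ‖(B ^ n) x‖ ≤ (max 1 ‖B‖) ^ g * ‖x‖ := by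
  have h : ∀ n, ‖(B ^ n) x‖ ≤ (max 1 ‖B‖) ^ n * ‖x‖ := by
    intro n
    induction n with
    | zero => simp
    | succ n ih =>
      rw [pow_succ', mul_apply_eq_comp, pow_succ', mul_assoc]
      exact (B.le_opNorm _).trans (mul_le_mul (le_max_right _ _) ih (norm_nonneg _) (by positivity))
  exact (h n).trans (mul_le_mul_of_nonneg_right
    (pow_le_pow_right₀ (le_max_left _ _) hn) (norm_nonneg _))

section Shift

variable {ι : Type*} [DecidableEq ι] {E : ι → Type*} [∀ i, NormedAddCommGroup (E i)]
  [∀ i, NormedSpace ℝ (E i)] {p : ℝ≥0∞} [Fact (1 ≤ p)] {σ : ι → ι} {B : lp E p →L[ℝ] lp E p}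

theorem single_pow_apply
    (hB : ∀ (x : lp E p) i, B (lp.single p (σ i) (x (σ i))) = lp.single p i (B x i))
    (n : ℕ) (x : lp E p) (i : ι) :
    (B ^ n) (lp.single p (σ^[n] i) (x (σ^[n] i))) = lp.single p i ((B ^ n) x i) := by
  induction n generalizing x i with
  | zero => rfl
  | succ n ih =>
    rw [pow_succ, mul_apply_eq_comp, Function.iterate_succ_apply', hB, ih]
    rfl

theorem pow_single_eq_zero
    (hB : ∀ (x : lp E p) i, B (lp.single p (σ i) (x (σ i))) = lp.single p i (B x i))
    (hB₀ : ∀ j ∉ Set.range σ, ∀ u, B (lp.single p j u) = 0)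
    {n : ℕ} {j : ι} (hj : ∀ i, σ^[n] i ≠ j) (u : E j) : (B ^ n) (lp.single p j u) = 0 := by
  induction n generalizing j with
  | zero => exact absurd rfl (hj j)
  | succ n ih =>
    rw [pow_succ, mul_apply_eq_comp]
    by_cases h : j ∈ Set.range σ
    · obtain ⟨i, rfl⟩ := h
      have := hB (lp.single p (σ i) u) i
      rw [lp.single_apply_self] at this
      rw [this]
      refine ih (fun k hk => hj k ?_) _
      rw [Function.iterate_succ_apply', hk]
    · rw [hB₀ j h, map_zero]

theorem FrequentlyHypercyclic.exists_norm_pow_single_lt (hp : p ≠ ∞)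
    (hσ : ∀ j, ∀ n ≥ 1, σ^[n] j ≠ j)
    (hB : ∀ (x : lp E p) i, B (lp.single p (σ i) (x (σ i))) = lp.single p i (B x i))
    (hB₀ : ∀ j ∉ Set.range σ, ∀ u, B (lp.single p j u) = 0)
    (h : FrequentlyHypercyclic ⇑B) (j : ι) (u : E j) {r : ℝ} (hr : 0 < r) :
    ∃ N : ℕ, ∀ n ≥ N, ∃ u', ‖u' - u‖ < r ∧ ‖(B ^ n) (lp.single p j u')‖ < r := by
  have hp0 : p ≠ 0 := (zero_lt_one.trans_le (Fact.out : 1 ≤ p)).ne'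
  obtain ⟨y, hy⟩ := h
  obtain ⟨g, S, hS, hcoin⟩ := exists_syndetic_coincidences
    (hy (Metric.ball (lp.single p j u) r) Metric.isOpen_ball ⟨_, Metric.mem_ball_self hr⟩)
  by_contra! hbad
  set M := (max 1 ‖B‖) ^ g
  have hM : 0 < M := by positivity
  set K : Set ℕ := {k ∈ S | ∀ u', ‖u' - u‖ < r → r / M ≤ ‖(B ^ k) (lp.single p j u')‖}
  have hK : K.Infinite := by
    refine Set.infinite_of_not_bddAbove fun ⟨N, hN⟩ => ?_
    obtain ⟨n, hn, hnbad⟩ := hbad (N + 1 + g)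
    obtain ⟨s, hsS, hs1, hs2⟩ := hS (n - g)
    have : s ≤ N := hN ⟨hsS, fun u' hu' => by
      rw [div_le_iff₀' hM]
      refine (hnbad u' hu').trans ?_
      have hle := norm_pow_apply_le B (show n - s ≤ g by omega) ((B ^ s) (lp.single p j u'))
      rwa [← mul_apply_eq_comp, ← pow_add, show n - s + s = n by omega] at hle⟩
    omega
  obtain ⟨-, n, hn, F, hFK, hC, hF⟩ :=
    hcoin K (fun k hk => hk.1) hK (((‖lp.single p j u‖ + r) / (r / M)) ^ p.toReal)
  have hidx : ∀ k ∈ F, ∃ i, σ^[k] i = j := by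
    intro k hk
    by_contra! hno
    have h1 := (hFK hk).2 u (by simpa using hr)
    rw [pow_single_eq_zero hB hB₀ hno, norm_zero] at h1
    exact (div_pos hr hM).not_ge h1
  have : Nonempty ι := ⟨j⟩
  choose! idx hidx using hidx
  refine hC.not_ge (lp_card_le_of_forall_le_norm (ENNReal.toReal_pos hp0 hp) ((B ^ n) y)
    (idx := idx) ?_ (div_pos hr hM) ?_ ?_)
  · have key : ∀ k ∈ F, ∀ l ∈ F, idx k = idx l → ¬ k < l := by
      intro k hk l hl hkl hlt
      refine hσ j (l - k) (by omega) ?_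
      conv_lhs => rw [← hidx k hk, hkl]
      rw [← Function.iterate_add_apply, show l - k + k = l by omega, hidx l hl]
    intro k hk l hl hkl
    have h1 := key k hk l hl hkl
    have h2 := key l hl k hk hkl.symm
    omega
  · intro k hk
    obtain ⟨m, hm, rfl⟩ := hF k hk
    have hm' : ‖(B ^ m) y - lp.single p j u‖ < r := by
      rw [FunLike.coe_pow_eq_iterate]; exact mem_ball_iff_norm.1 hm
    have h1 := (hFK hk).2 ((B ^ m) y j) (by
      have := lp.norm_apply_le_norm hp0 ((B ^ m) y - lp.single p j u) j
      rw [lp.coeFn_sub, Pi.sub_apply, lp.single_apply_self] at this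
      exact this.trans_lt hm')
    have h2 := single_pow_apply hB k ((B ^ m) y) (idx k)
    rw [hidx k hk, ← mul_apply_eq_comp, ← pow_add, add_comm] at h2
    rwa [h2, lp.norm_single (pos_iff_ne_zero.2 hp0)] at h1
  · have hn' : ‖(B ^ n) y - lp.single p j u‖ < r := by
      rw [FunLike.coe_pow_eq_iterate]; exact mem_ball_iff_norm.1 hn
    linarith [norm_sub_norm_le ((B ^ n) y) (lp.single p j u)]

theorem FrequentlyHypercyclic.exists_norm_pow_sub_single_lt (hp : p ≠ ∞)
    (hσinj : Function.Injective σ) (hσ : ∀ j, ∀ n ≥ 1, σ^[n] j ≠ j)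
    (hB : ∀ (x : lp E p) i, B (lp.single p (σ i) (x (σ i))) = lp.single p i (B x i))
    (h : FrequentlyHypercyclic ⇑B) (j : ι) (u : E j) {r : ℝ} (hr : 0 < r) :
    ∃ N : ℕ, ∀ n ≥ N, ∃ z, ‖z‖ < r ∧ ‖(B ^ n) z - lp.single p j u‖ < r := by
  have hp0 : p ≠ 0 := (zero_lt_one.trans_le (Fact.out : 1 ≤ p)).ne'
  obtain ⟨y, hy⟩ := h
  obtain ⟨g, S, hS, hcoin⟩ := exists_syndetic_coincidences
    (hy (Metric.ball (lp.single p j u) r) Metric.isOpen_ball ⟨_, Metric.mem_ball_self hr⟩)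
  by_contra! hbad
  set M := (max 1 ‖B‖) ^ g
  have hM : 0 < M := by positivity
  set K : Set ℕ := {k ∈ S | ∀ z : lp E p, ‖z‖ < r / M → r ≤ ‖((B ^ k) z) j - u‖}
  have hK : K.Infinite := by
    refine Set.infinite_of_not_bddAbove fun ⟨N, hN⟩ => ?_
    obtain ⟨n, hn, hnbad⟩ := hbad (N + 1)
    obtain ⟨s, hsS, hs1, hs2⟩ := hS n
    have : s ≤ N := hN ⟨hsS, fun z hz => by
      set w := (B ^ (s - n)) z
      have hw : ‖w‖ < r := by
        rw [lt_div_iff₀' hM] at hz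
        exact (norm_pow_apply_le B (show s - n ≤ g by omega) z).trans_lt hz
      have h1 := hnbad (lp.single p (σ^[n] j) (w (σ^[n] j))) (by
        rw [lp.norm_single (pos_iff_ne_zero.2 hp0)]
        exact (lp.norm_apply_le_norm hp0 w _).trans_lt hw)
      rw [single_pow_apply hB, ← lp.single_sub, lp.norm_single (pos_iff_ne_zero.2 hp0)] at h1
      simp only [w] at h1
      rwa [← mul_apply_eq_comp, ← pow_add, show n + (s - n) = s by omega] at h1⟩
    omega
  obtain ⟨⟨n, hn, F, hFK, hC, hF⟩, -⟩ :=
    hcoin K (fun k hk => hk.1) hK (((‖lp.single p j u‖ + r) / (r / M)) ^ p.toReal)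
  refine hC.not_ge (lp_card_le_of_forall_le_norm (ENNReal.toReal_pos hp0 hp) ((B ^ n) y)
    (idx := fun k => σ^[k] j) ?_ (div_pos hr hM) ?_ ?_)
  · have key : ∀ k l, σ^[k] j = σ^[l] j → ¬ k < l := by
      intro k l hkl hlt
      refine hσ j (l - k) (by omega) ((hσinj.iterate k) ?_)
      rw [← Function.iterate_add_apply, show k + (l - k) = l by omega, hkl]
    intro k hk l hl hkl
    have h1 := key k l hkl
    have h2 := key l k hkl.symm
    omega
  · intro k hk
    by_contra! hlt
    have h1 := (hFK hk).2 (lp.single p (σ^[k] j) ((B ^ n) y (σ^[k] j)))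
      (by rwa [lp.norm_single (pos_iff_ne_zero.2 hp0)])
    rw [single_pow_apply hB, lp.single_apply_self, ← mul_apply_eq_comp, ← pow_add,
      add_comm] at h1
    have hm' : ‖(B ^ (n + k)) y - lp.single p j u‖ < r := by
      rw [FunLike.coe_pow_eq_iterate]; exact mem_ball_iff_norm.1 (hF k hk)
    have h2 := lp.norm_apply_le_norm hp0 ((B ^ (n + k)) y - lp.single p j u) j
    rw [lp.coeFn_sub, Pi.sub_apply, lp.single_apply_self] at h2
    linarith
  · have hn' : ‖(B ^ n) y - lp.single p j u‖ < r := by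
      rw [FunLike.coe_pow_eq_iterate]; exact mem_ball_iff_norm.1 hn
    linarith [norm_sub_norm_le ((B ^ n) y) (lp.single p j u)]

/-- A frequently hypercyclic operator shift along an injective, fixed-point-free (with all its
iterates) self-map of the index set is mixing. -/
theorem FrequentlyHypercyclic.topologicallyMixing_of_shift (hp : p ≠ ∞)
    (hσinj : Function.Injective σ) (hσ : ∀ j, ∀ n ≥ 1, σ^[n] j ≠ j)
    (T : ∀ i, E (σ i) →L[ℝ] E i) (hT : ∀ (x : lp E p) i, (B x) i = T i (x (σ i)))
    (h : FrequentlyHypercyclic ⇑B) : TopologicallyMixing ⇑B := by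
  have hB₀ : ∀ j ∉ Set.range σ, ∀ u, B (lp.single p j u) = 0 := by
    intro j hj u
    ext i
    rw [hT, lp.single_apply_ne _ _ _ fun hij => hj ⟨i, hij⟩, map_zero]
    rfl
  have hB : ∀ (x : lp E p) i, B (lp.single p (σ i) (x (σ i))) = lp.single p i (B x i) := by
    intro x i
    ext k
    rw [hT]
    rcases eq_or_ne k i with rfl | hki
    · rw [lp.single_apply_self, lp.single_apply_self, hT]
    · rw [lp.single_apply_ne _ _ _ hki, lp.single_apply_ne _ _ _ (hσinj.ne hki), map_zero]
  refine topologicallyMixing_of_forall B (fun x ε hε => ?_) fun x ε hε => ?_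
  · refine lp_induction_of_approx hp
      (P := fun x ε => ∃ N : ℕ, ∀ n ≥ N, ∃ u, ‖u - x‖ < ε ∧ ‖(B ^ n) u‖ < ε)
      ?_ ?_ ?_ ?_ x hε
    · rintro x ε hε ⟨y, hyx, N, hN⟩
      refine ⟨N, fun n hn => ?_⟩
      obtain ⟨u, hu, hBu⟩ := hN n hn
      refine ⟨u, ?_, by linarith⟩
      linarith [norm_sub_le_norm_sub_add_norm_sub u y x]
    · rintro x y ε ⟨N₁, h₁⟩ ⟨N₂, h₂⟩
      refine ⟨max N₁ N₂, fun n hn => ?_⟩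
      obtain ⟨u, hu, hBu⟩ := h₁ n (le_of_max_le_left hn)
      obtain ⟨v, hv, hBv⟩ := h₂ n (le_of_max_le_right hn)
      refine ⟨u + v, ?_, ?_⟩
      · rw [add_sub_add_comm]
        linarith [norm_add_le (u - x) (v - y)]
      · rw [map_add]
        linarith [norm_add_le ((B ^ n) u) ((B ^ n) v)]
    · exact fun ε hε => ⟨0, fun n _ => ⟨0, by simpa using hε, by simpa using hε⟩⟩
    · intro i u ε hε
      obtain ⟨N, hN⟩ := h.exists_norm_pow_single_lt hp hσ hB hB₀ i u hε
      refine ⟨N, fun n hn => ?_⟩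
      obtain ⟨u', hu', hBu'⟩ := hN n hn
      refine ⟨lp.single p i u', ?_, hBu'⟩
      rwa [← lp.single_sub, lp.norm_single (zero_lt_one.trans_le Fact.out)]
  · refine lp_induction_of_approx hp
      (P := fun x ε => ∃ N : ℕ, ∀ n ≥ N, ∃ z, ‖z‖ < ε ∧ ‖(B ^ n) z - x‖ < ε)
      ?_ ?_ ?_ ?_ x hε
    · rintro x ε hε ⟨y, hyx, N, hN⟩
      refine ⟨N, fun n hn => ?_⟩
      obtain ⟨z, hz, hBz⟩ := hN n hn
      refine ⟨z, by linarith, ?_⟩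
      linarith [norm_sub_le_norm_sub_add_norm_sub ((B ^ n) z) y x]
    · rintro x y ε ⟨N₁, h₁⟩ ⟨N₂, h₂⟩
      refine ⟨max N₁ N₂, fun n hn => ?_⟩
      obtain ⟨z, hz, hBz⟩ := h₁ n (le_of_max_le_left hn)
      obtain ⟨w, hw, hBw⟩ := h₂ n (le_of_max_le_right hn)
      refine ⟨z + w, by linarith [norm_add_le z w], ?_⟩
      rw [map_add, add_sub_add_comm]
      linarith [norm_add_le ((B ^ n) z - x) ((B ^ n) w - y)]
    · exact fun ε hε => ⟨0, fun n _ => ⟨0, by simpa using hε, by simpa using hε⟩⟩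
    · exact fun i u ε hε => h.exists_norm_pow_sub_single_lt hp hσinj hσ hB i u hε

end Shift

/-- if the shift `B_{(T_k)}` is frequently hypercyclic on `ℓ^p((X_k)_k,J)`
(`J = ℕ` or `ℤ`), then it is mixing. -/
theorem stmt_14 (EN : ℕ → Type*) [∀ k, NormedAddCommGroup (EN k)] [∀ k, NormedSpace ℝ (EN k)]
    [∀ k, CompleteSpace (EN k)] (TN : ∀ k : ℕ, EN (k + 1) →L[ℝ] EN k)
    (EZ : ℤ → Type*) [∀ k, NormedAddCommGroup (EZ k)] [∀ k, NormedSpace ℝ (EZ k)]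
    [∀ k, CompleteSpace (EZ k)] (TZ : ∀ k : ℤ, EZ (k + 1) →L[ℝ] EZ k)
    (p : ℝ≥0∞) [Fact (1 ≤ p)] (hp : p ≠ ∞) :
    (∀ B : lp EN p →L[ℝ] lp EN p,
      (∀ (x : lp EN p) (k : ℕ), (B x : ∀ i, EN i) k = TN k ((x : ∀ i, EN i) (k + 1))) →
      FrequentlyHypercyclic ⇑B → TopologicallyMixing ⇑B)
    ∧ (∀ B : lp EZ p →L[ℝ] lp EZ p,
      (∀ (x : lp EZ p) (k : ℤ), (B x : ∀ i, EZ i) k = TZ k ((x : ∀ i, EZ i) (k + 1))) →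
      FrequentlyHypercyclic ⇑B → TopologicallyMixing ⇑B) := by
  refine ⟨fun B hB h => ?_, fun B hB h => ?_⟩
  · refine h.topologicallyMixing_of_shift hp (σ := fun k => k + 1) (add_left_injective 1)
      (fun j n hn => ?_) TN hB
    rw [add_right_iterate]
    simp only [smul_eq_mul]
    omega
  · refine h.topologicallyMixing_of_shift hp (σ := fun k => k + 1) (add_left_injective 1)
      (fun j n hn => ?_) TZ hB
    rw [add_right_iterate]
    simp only [nsmul_eq_mul]
    omega
end

section
/- Let $T$ be a bounded operator on a separable Banach space $X$. The bilateral shift $B_T$ is chaotic on $\ell^1(X,\mathbb{Z})$ if and only if $T$ satisfies the Frequent Hypercyclicity Criterion with $X_0=Y_0$: there exist a dense subset $X_0\subseteq X$ and a map $S:X_0\to X_0$ such that for all $x\in X_0$, $\sum_{n\ge1}\|T^nx\|<\infty$, $\sum_{n\ge1}\|S^nx\|<\infty$, and $TSx=x$. -/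
open Filter Topology ENNReal

section SummableOrbit

variable {X : Type*} [NormedAddCommGroup X] [NormedSpace ℝ X]

/-- A two-sided orbit of `T`, indexed backwards in time, with summable norms. These are the fixed
points of the bilateral shift `B_T` on `ℓ¹(X,ℤ)`. -/
structure IsSummableOrbit (T : X →L[ℝ] X) (y : ℤ → X) : Prop where
  map_succ : ∀ n, T (y (n + 1)) = y n
  summable : Summable fun n => ‖y n‖

namespace IsSummableOrbit

variable {T : X →L[ℝ] X} {y : ℤ → X}

theorem iterate (hy : IsSummableOrbit T y) (n : ℕ) (k : ℤ) : (⇑T)^[n] (y (k + n)) = y k := by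
  induction n generalizing k with
  | zero => simp
  | succ n ih =>
    rw [Function.iterate_succ_apply, ← ih k, ← hy.map_succ (k + n)]
    push_cast
    rw [add_assoc]

theorem tendsto_norm (hy : IsSummableOrbit T y) {g : ℕ → ℤ} (hg : Function.Injective g) :
    Tendsto (fun n => ‖y (g n)‖) atTop (𝓝 0) := by
  rw [← Nat.cofinite_eq_atTop]
  exact hy.summable.tendsto_cofinite_zero.comp hg.tendsto_cofinite

theorem eq_zero_of_eq_add (hy : IsSummableOrbit T y) {a : ℤ} {p : ℕ} (hp : p ≠ 0)
    (h : y a = y (a + p)) : y a = 0 := by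
  have key : ∀ j : ℕ, y (a - j * p) = y a := by
    intro j
    induction j with
    | zero => simp
    | succ j ih =>
      rw [← hy.iterate p (a - (j + 1 : ℕ) * p),
        show a - ((j + 1 : ℕ) : ℤ) * p + p = a - j * p by push_cast; ring, ih, h, hy.iterate, h]
  have ht : Tendsto (fun j : ℕ => ‖y (a - j * p)‖) atTop (𝓝 0) :=
    hy.tendsto_norm fun i j hij => by simpa [hp] using hij
  simp only [key] at ht
  exact norm_eq_zero.1 (tendsto_nhds_unique tendsto_const_nhds ht)

theorem eq_of_apply_eq (hy : IsSummableOrbit T y) {a b : ℤ} (h : y a = y b) (h0 : y a ≠ 0) :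
    a = b := by
  by_contra hab
  rcases lt_or_gt_of_ne hab with hlt | hlt
  · obtain ⟨p, rfl⟩ := Int.le.dest hlt.le
    exact h0 (hy.eq_zero_of_eq_add (by rintro rfl; simp at hlt) h)
  · obtain ⟨p, rfl⟩ := Int.le.dest hlt.le
    exact h0 (h.trans (hy.eq_zero_of_eq_add (by rintro rfl; simp at hlt) h.symm))

theorem shift (hy : IsSummableOrbit T y) (k : ℤ) : IsSummableOrbit T fun n => y (n + k) where
  map_succ n := by rw [add_right_comm]; exact hy.map_succ _
  summable := hy.summable.comp_injective (add_left_injective k)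

end IsSummableOrbit

/-- A consistent right inverse of `T` along summable orbits: each point is assigned the least orbit,
in some well-order, passing through it. -/
theorem exists_rightInverse_of_summableOrbits (T : X →L[ℝ] X) :
    ∃ S : X → X, ∀ x ∈ {x | ∃ y, IsSummableOrbit T y ∧ y 0 = x},
      S x ∈ {x | ∃ y, IsSummableOrbit T y ∧ y 0 = x} ∧
        Summable (fun n : ℕ => ‖S^[n] x‖) ∧ T (S x) = x := by
  classical
  set X₀ : Set X := {x | ∃ y, IsSummableOrbit T y ∧ y 0 = x}
  obtain ⟨_, _⟩ := exists_wellFoundedLT (α := {y : ℤ → X // IsSummableOrbit T y})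
  have mem (f : {y : ℤ → X // IsSummableOrbit T y}) (n : ℤ) : f.1 n ∈ X₀ :=
    ⟨_, f.2.shift n, by simp⟩
  have hmin : ∀ x : X, ∃ (f : {y : ℤ → X // IsSummableOrbit T y}) (n : ℤ), x ∈ X₀ →
      f.1 n = x ∧ ∀ (g : {y : ℤ → X // IsSummableOrbit T y}) (m : ℤ), g.1 m = x → f ≤ g := by
    intro x
    by_cases hx : x ∈ X₀
    · obtain ⟨y, hy, hyx⟩ := hx
      obtain ⟨f, ⟨n, hn⟩, hf⟩ := WellFounded.has_min
        (wellFounded_lt (α := {y : ℤ → X // IsSummableOrbit T y}))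
        {f | ∃ n, f.1 n = x} ⟨⟨y, hy⟩, 0, hyx⟩
      exact ⟨f, n, fun _ => ⟨hn, fun g m hg => not_lt.1 (hf g ⟨m, hg⟩)⟩⟩
    · exact ⟨⟨fun _ => 0, fun _ => map_zero T, by simp [summable_zero]⟩, 0, fun h => absurd h hx⟩
  choose κ N hκ using hmin
  set S : X → X := fun x => if x = 0 then 0 else (κ x).1 (N x + 1)
  have S_zero : S 0 = 0 := if_pos rfl
  have S_apply {x : X} (hx : x ≠ 0) : S x = (κ x).1 (N x + 1) := if_neg hx
  have S_mem : ∀ x ∈ X₀, S x ∈ X₀ := by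
    intro x hx
    by_cases h0 : x = 0
    · rwa [h0, S_zero, ← h0]
    · rw [S_apply h0]; exact mem _ _
  have iter_mem : ∀ x ∈ X₀, ∀ n, S^[n] x ∈ X₀ := fun x hx n =>
    Set.MapsTo.iterate (f := S) (s := X₀) S_mem n hx
  refine ⟨S, fun x hx => ⟨S_mem x hx, ?_, ?_⟩⟩
  · induction hf : κ x using WellFoundedLT.induction generalizing x with
    | ind f ih =>
    by_cases h0 : x = 0
    · simp [h0, Function.iterate_fixed S_zero, summable_zero]
    by_cases hlt : ∃ n, κ (S^[n] x) < f
    · obtain ⟨n, hn⟩ := hlt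
      have := ih _ hn (S^[n] x) (iter_mem x hx n) rfl
      simp only [← Function.iterate_add_apply] at this
      exact (summable_nat_add_iff n).1 this
    · push Not at hlt
      have hxf : f.1 (N x) = x := hf ▸ (hκ x hx).1
      have key : ∀ n : ℕ, S^[n] x = f.1 (N x + n) := by
        intro n
        induction n with
        | zero => simpa using hxf.symm
        | succ n ihn =>
          have hz0 : S^[n] x ≠ 0 := fun h => h0 <| by
            rw [← hxf, ← f.2.iterate n, ← ihn, h, iterate_map_zero]
          obtain ⟨hz, hzmin⟩ := hκ _ (iter_mem x hx n)
          have hκz : κ (S^[n] x) = f := le_antisymm (hzmin f _ ihn.symm) (hlt n)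
          rw [hκz] at hz
          have hN : N (S^[n] x) = N x + n :=
            f.2.eq_of_apply_eq (hz.trans ihn) (by rwa [hz])
          rw [Function.iterate_succ_apply', S_apply hz0, hκz, hN]
          push_cast
          rw [add_assoc]
      simp only [key]
      exact f.2.summable.comp_injective (i := fun n : ℕ => N x + (n : ℤ))
        fun i j hij => by simpa using hij
  · by_cases h0 : x = 0
    · rw [h0, S_zero, map_zero]
    · rw [S_apply h0, (κ x).2.map_succ, (hκ x hx).1]

/-- The two-sided orbit through `x` built from forward iterates of `T` and of a right inverse. -/
theorem exists_isSummableOrbit {T : X →L[ℝ] X} {X₀ : Set X} {S : X → X}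
    (hS : ∀ x ∈ X₀, S x ∈ X₀) (hTS : ∀ x ∈ X₀, T (S x) = x) {x : X} (hx : x ∈ X₀)
    (hT : Summable fun n : ℕ => ‖(⇑T)^[n + 1] x‖) (hs : Summable fun n : ℕ => ‖S^[n + 1] x‖) :
    ∃ y, IsSummableOrbit T y ∧ y 0 = x := by
  let y : ℤ → X := fun n => Int.rec (fun n => S^[n] x) (fun n => (⇑T)^[n + 1] x) n
  refine ⟨y, ⟨?_, ?_⟩, rfl⟩
  · rintro (n | n)
    · change T (S^[n + 1] x) = S^[n] x
      rw [Function.iterate_succ_apply', hTS]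
      exact Set.MapsTo.iterate (f := S) (s := X₀) hS n hx
    · cases n with
      | zero => rfl
      | succ n => exact (Function.iterate_succ_apply' (⇑T) (n + 1) x).symm
  · refine Summable.of_nat_of_neg_add_one ((summable_nat_add_iff 1).1 hs) ?_
    simpa only [← Int.negSucc_eq] using hT

/-- Interpolating a `d`-periodic point of the bilateral shift along multiples of `d`. -/
theorem exists_isSummableOrbit_of_periodic {T : X →L[ℝ] X} {x : ℤ → X} {d : ℕ} (hd : 1 ≤ d)
    (hx : Summable fun n => ‖x n‖) (hper : ∀ n, (⇑T)^[d] (x (n + d)) = x n) :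
    ∃ y, IsSummableOrbit T y ∧ y 0 = x 0 := by
  have hd0 : (d : ℤ) ≠ 0 := by omega
  let r : ℤ → ℕ := fun n => ((-n) % d).toNat
  have hr (n : ℤ) : (r n : ℤ) = (-n) % d := Int.toNat_of_nonneg (Int.emod_nonneg _ hd0)
  have hrlt (n : ℤ) : r n < d := by
    have := Int.emod_lt_of_pos (-n) (show (0 : ℤ) < d by omega)
    have := hr n
    omega
  refine ⟨fun n => (⇑T)^[r n] (x (n + r n)), ⟨fun n => ?_, ?_⟩, by simp [r]⟩
  · have hmod : ((r n : ℤ) - (r (n + 1) + 1)) % d = 0 := by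
      rw [hr, hr]
      apply Int.emod_eq_zero_of_dvd
      have h1 := Int.emod_add_mul_ediv (-n) d
      have h2 := Int.emod_add_mul_ediv (-(n + 1)) d
      exact ⟨(-(n + 1)) / d - (-n) / d, by linear_combination h1 - h2⟩
    have hn := hrlt n
    have hn1 := hrlt (n + 1)
    rw [← Function.iterate_succ_apply' (⇑T)]
    rcases Nat.lt_or_ge (r (n + 1) + 1) d with h | h
    · have : r n = r (n + 1) + 1 := by
        obtain ⟨c, hc⟩ := Int.dvd_of_emod_eq_zero hmod
        have : c = 0 := by
          have h1 : c < 1 := by by_contra! h; nlinarith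
          have h2 : -1 < c := by by_contra! h; nlinarith
          omega
        subst this; omega
      rw [this]
      push_cast
      rw [show n + 1 + (r (n + 1) : ℤ) = n + (r (n + 1) + 1) by ring]
    · have h' : r (n + 1) + 1 = d := by omega
      have h0 : r n = 0 := by
        obtain ⟨c, hc⟩ := Int.dvd_of_emod_eq_zero hmod
        have hc' : (r n : ℤ) = d * (c + 1) := by
          have : (r (n + 1) : ℤ) + 1 = d := by exact_mod_cast h'
          linear_combination hc + this
        have h1 : c < 0 := by by_contra! h; nlinarith
        nlinarith
      rw [Nat.succ_eq_add_one, h', h0, show n + 1 + (r (n + 1) : ℤ) = n + d by omega, hper]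
      simp
  · have hsum : Summable fun n => (1 + ‖T‖) ^ d * ∑ i ∈ Finset.range d, ‖x (n + i)‖ :=
      (summable_sum (f := fun (i : ℕ) n => ‖x (n + i)‖)
        fun i _ => hx.comp_injective (add_left_injective (i : ℤ))).mul_left _
    refine hsum.of_nonneg_of_le (fun n => norm_nonneg _) fun n => ?_
    calc ‖(⇑T)^[r n] (x (n + r n))‖ ≤ ‖T‖ ^ r n * ‖x (n + r n)‖ := by
          simpa using (T.lipschitz.iterate (r n)).norm_le_mul (iterate_map_zero T _) (x (n + r n))
      _ ≤ (1 + ‖T‖) ^ d * ∑ i ∈ Finset.range d, ‖x (n + i)‖ := by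
          gcongr
          · calc ‖T‖ ^ r n ≤ (1 + ‖T‖) ^ r n := by gcongr; linarith
              _ ≤ (1 + ‖T‖) ^ d :=
                pow_le_pow_right₀ (by linarith [norm_nonneg T]) (hrlt n).le
          · exact Finset.single_le_sum (f := fun i : ℕ => ‖x (n + i)‖)
              (fun _ _ => norm_nonneg _) (Finset.mem_range.2 (hrlt n))

end SummableOrbit

/-- Birkhoff's transitivity theorem. -/
theorem TopologicallyTransitive.hypercyclic {Y : Type*} [TopologicalSpace Y] [BaireSpace Y]
    [SecondCountableTopology Y] [Nonempty Y] {f : Y → Y} (hf : Continuous f)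
    (h : TopologicallyTransitive f) : Hypercyclic f := by
  have hb := TopologicalSpace.isBasis_countableBasis Y
  have hdense : Dense (⋂ b ∈ TopologicalSpace.countableBasis Y, ⋃ n : ℕ, f^[n] ⁻¹' b) := by
    refine dense_biInter_of_isOpen
      (fun b hb' => isOpen_iUnion fun n => (hb.isOpen hb').preimage (hf.iterate n))
      (TopologicalSpace.countable_countableBasis Y) fun b hb' => ?_
    rw [dense_iff_inter_open]
    intro U hU hUne
    obtain ⟨n, _, ⟨u, hu, rfl⟩, hv⟩ := h U b hU (hb.isOpen hb') hUne
      (TopologicalSpace.nonempty_of_mem_countableBasis hb')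
    exact ⟨u, hu, Set.mem_iUnion.2 ⟨n, hv⟩⟩
  obtain ⟨y, hy⟩ := hdense.nonempty
  refine ⟨y, hb.dense_iff.2 fun b hb' _ => ?_⟩
  obtain ⟨n, hn⟩ := Set.mem_iUnion.1 (Set.mem_iInter₂.1 hy b hb')
  exact ⟨_, hn, n, rfl⟩

section Lp

variable {ι X : Type*} [NormedAddCommGroup X]

theorem memℓp_one_iff {x : ι → X} : Memℓp x 1 ↔ Summable fun i => ‖x i‖ := by
  simp [memℓp_gen_iff (p := 1) (by simp)]

theorem lp.norm_eq_tsum_one (x : lp (fun _ : ι => X) 1) : ‖x‖ = ∑' i, ‖x i‖ := by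
  simp [lp.norm_eq_tsum_rpow (p := 1) (by simp)]

variable [DecidableEq ι]

theorem lp.dense_of_single_mem {M : AddSubmonoid (lp (fun _ : ι => X) 1)} {D : Set X}
    (hD : Dense D) (h : ∀ i, ∀ x ∈ D, lp.single 1 i x ∈ M) :
    Dense (M : Set (lp (fun _ : ι => X) 1)) := by
  have hsingle (i : ι) (x : X) :
      (lp.single 1 i x : lp (fun _ : ι => X) 1) ∈ M.topologicalClosure :=
    map_mem_closure (lp.isometry_single (E := fun _ : ι => X) (p := 1) i).continuous (hD x)
      fun a ha => h i a ha
  intro x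
  exact M.isClosed_topologicalClosure.mem_of_tendsto (lp.hasSum_single one_ne_top x)
    (Eventually.of_forall fun s => sum_mem fun i _ => hsingle i _)

instance [Countable ι] [NormedSpace ℝ X] [TopologicalSpace.SeparableSpace X] :
    TopologicalSpace.SeparableSpace (lp (fun _ : ι => X) 1) := by
  have hcont (i : ι) : Continuous (lp.single (E := fun _ : ι => X) 1 i) :=
    (lp.isometry_single (E := fun _ : ι => X) (p := 1) i).continuous
  have hs : TopologicalSpace.IsSeparable
      (⋃ i : ι, Set.range (lp.single (E := fun _ : ι => X) 1 i)) :=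
    .iUnion fun i => TopologicalSpace.isSeparable_range (hcont i)
  have hd := lp.dense_of_single_mem (ι := ι) (X := X)
    (M := (Submodule.span ℝ
      (⋃ i : ι, Set.range (lp.single (E := fun _ : ι => X) 1 i))).toAddSubmonoid)
    dense_univ fun i x _ => Submodule.subset_span (Set.mem_iUnion.2 ⟨i, x, rfl⟩)
  rw [← TopologicalSpace.isSeparable_univ_iff, ← hd.closure_eq]
  exact (hs.span (R := ℝ)).closure

end Lp

section BilateralShift

variable {X : Type*} [NormedAddCommGroup X] [NormedSpace ℝ X] {T : X →L[ℝ] X}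
  {B : lp (fun _ : ℤ => X) 1 →L[ℝ] lp (fun _ : ℤ => X) 1}

theorem bilateralShift_iterate_apply
    (hB : ∀ (x : lp (fun _ : ℤ => X) 1) (n : ℤ), (B x : ℤ → X) n = T ((x : ℤ → X) (n + 1)))
    (k : ℕ) (x : lp (fun _ : ℤ => X) 1) (n : ℤ) :
    ((⇑B)^[k] x : ℤ → X) n = (⇑T)^[k] ((x : ℤ → X) (n + k)) := by
  induction k generalizing x with
  | zero => simp
  | succ k ih =>
    rw [Function.iterate_succ_apply, ih, hB, Function.iterate_succ_apply]
    push_cast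
    rw [add_assoc]

theorem bilateralShift_iterate_single
    (hB : ∀ (x : lp (fun _ : ℤ => X) 1) (n : ℤ), (B x : ℤ → X) n = T ((x : ℤ → X) (n + 1)))
    (k : ℕ) (i : ℤ) (v : X) :
    (⇑B)^[k] (lp.single 1 i v) = lp.single 1 (i - k) ((⇑T)^[k] v) := by
  ext n
  rw [bilateralShift_iterate_apply hB, lp.single_apply, lp.single_apply, Pi.single_apply,
    Pi.single_apply]
  by_cases h : n = i - k
  · rw [if_pos h, if_pos (by omega)]
  · rw [if_neg h, if_neg (by omega), iterate_map_zero]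

theorem exists_periodic_tendsto_single
    (hB : ∀ (x : lp (fun _ : ℤ => X) 1) (n : ℤ), (B x : ℤ → X) n = T ((x : ℤ → X) (n + 1)))
    {y : ℤ → X} (hy : IsSummableOrbit T y) (k : ℤ) :
    ∃ v : ℕ → lp (fun _ : ℤ => X) 1,
      (∀ d, (⇑B)^[d] (v d) = v d) ∧ Tendsto v atTop (𝓝 (lp.single 1 k (y 0))) := by
  have hsum : Summable fun n => ‖y (n - k)‖ := hy.summable.comp_injective (sub_left_injective)
  let w : ℕ → ℤ → X := fun d n => if (d : ℤ) ∣ n - k then y (n - k) else 0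
  have hw (d : ℕ) : Memℓp (w d) 1 := memℓp_one_iff.2 <|
    hsum.of_nonneg_of_le (fun _ => norm_nonneg _) fun n => by
      simp only [w]; split_ifs <;> simp
  refine ⟨fun d => ⟨w d, hw d⟩, fun d => ?_, ?_⟩
  · ext n
    rw [bilateralShift_iterate_apply hB]
    change (⇑T)^[d] (w d (n + d)) = w d n
    simp only [w, show n + (d : ℤ) - k = n - k + d by ring, dvd_add_self_right]
    split_ifs
    · exact hy.iterate d _
    · exact iterate_map_zero T d
  · rw [tendsto_iff_norm_sub_tendsto_zero]
    simp only [lp.norm_eq_tsum_one]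
    rw [← tsum_zero (α := ℝ) (β := ℤ)]
    refine tendsto_tsum_of_dominated_convergence hsum (fun n => ?_)
      (Eventually.of_forall fun d n => ?_)
    · refine tendsto_const_nhds.congr' ?_
      filter_upwards [eventually_gt_atTop (n - k).natAbs] with d hd
      change 0 = ‖w d n - (Pi.single k (y 0) : ℤ → X) n‖
      rw [Pi.single_apply]
      by_cases hnk : n = k
      · simp [w, hnk]
      · have : ¬ (d : ℤ) ∣ n - k := fun h => by
          have := Int.natAbs_dvd_natAbs.2 h
          have := Nat.le_of_dvd (by omega) this
          simp only [Int.natAbs_natCast] at this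
          omega
        simp [w, hnk, this]
    · rw [norm_norm]
      change ‖w d n - (Pi.single k (y 0) : ℤ → X) n‖ ≤ _
      rw [Pi.single_apply]
      by_cases hnk : n = k
      · simp [w, hnk]
      · simp only [w, hnk, if_false, sub_zero]
        split_ifs <;> simp

theorem dense_periodicPoints_of_summableOrbits
    (hB : ∀ (x : lp (fun _ : ℤ => X) 1) (n : ℤ), (B x : ℤ → X) n = T ((x : ℤ → X) (n + 1)))
    (hD : Dense {x | ∃ y, IsSummableOrbit T y ∧ y 0 = x}) :
    Dense {x : lp (fun _ : ℤ => X) 1 | ∃ d : ℕ, 1 ≤ d ∧ (⇑B)^[d] x = x} := by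
  let M : AddSubmonoid (lp (fun _ : ℤ => X) 1) :=
    { carrier := {u | ∃ v : ℕ → lp (fun _ : ℤ => X) 1,
        (∀ d, (⇑B)^[d] (v d) = v d) ∧ Tendsto v atTop (𝓝 u)}
      zero_mem' := ⟨fun _ => 0, fun d => iterate_map_zero B d, tendsto_const_nhds⟩
      add_mem' := by
        rintro a b ⟨v, hv, hva⟩ ⟨w, hw, hwb⟩
        exact ⟨fun d => v d + w d, fun d => by rw [iterate_map_add, hv, hw], hva.add hwb⟩ }
  have hM : Dense (M : Set (lp (fun _ : ℤ => X) 1)) :=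
    lp.dense_of_single_mem hD fun i x ⟨y, hy, hyx⟩ =>
      hyx ▸ exists_periodic_tendsto_single hB hy i
  refine dense_closure.1 (hM.mono ?_)
  rintro u ⟨v, hv, hvu⟩
  refine mem_closure_of_tendsto hvu ?_
  filter_upwards [eventually_ge_atTop 1] with d hd
  exact ⟨d, hd, hv d⟩

theorem topologicallyTransitive_of_summableOrbits
    (hB : ∀ (x : lp (fun _ : ℤ => X) 1) (n : ℤ), (B x : ℤ → X) n = T ((x : ℤ → X) (n + 1)))
    (hD : Dense {x | ∃ y, IsSummableOrbit T y ∧ y 0 = x}) : TopologicallyTransitive ⇑B := by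
  let P : AddSubmonoid (lp (fun _ : ℤ => X) 1) :=
    { carrier := {u | Tendsto (fun n : ℕ => (⇑B)^[n] u) atTop (𝓝 0)}
      zero_mem' := by simp [iterate_map_zero]
      add_mem' := fun {a b} ha hb => by
        simpa [iterate_map_add] using Tendsto.add (M := lp (fun _ : ℤ => X) 1) ha hb }
  let Q : AddSubmonoid (lp (fun _ : ℤ => X) 1) :=
    { carrier := {u | ∃ w : ℕ → lp (fun _ : ℤ => X) 1,
        (∀ n, (⇑B)^[n] (w n) = u) ∧ Tendsto w atTop (𝓝 0)}
      zero_mem' := ⟨fun _ => 0, fun n => iterate_map_zero B n, tendsto_const_nhds⟩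
      add_mem' := by
        rintro a b ⟨v, hv, hva⟩ ⟨w, hw, hwb⟩
        exact ⟨fun d => v d + w d, fun d => by rw [iterate_map_add, hv, hw],
          by simpa using hva.add hwb⟩ }
  have hP : Dense (P : Set (lp (fun _ : ℤ => X) 1)) := by
    refine lp.dense_of_single_mem hD ?_
    rintro i _ ⟨y, hy, rfl⟩
    refine tendsto_zero_iff_norm_tendsto_zero.2 ?_
    have hT (n : ℕ) : (⇑T)^[n] (y 0) = y (-n) := by simpa using hy.iterate n (-n)
    simp only [bilateralShift_iterate_single hB, lp.norm_single zero_lt_one, hT]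
    exact hy.tendsto_norm (g := fun n => -(n : ℤ)) fun a b h => by simpa using h
  have hQ : Dense (Q : Set (lp (fun _ : ℤ => X) 1)) := by
    refine lp.dense_of_single_mem hD ?_
    rintro i _ ⟨y, hy, rfl⟩
    refine ⟨fun n => lp.single 1 (i + n) (y n), fun n => ?_, ?_⟩
    · rw [bilateralShift_iterate_single hB, add_sub_cancel_right]
      have := hy.iterate n 0
      rw [zero_add] at this
      rw [this]
    · refine tendsto_zero_iff_norm_tendsto_zero.2 ?_
      simp only [lp.norm_single zero_lt_one]
      exact hy.tendsto_norm Nat.cast_injective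
  intro U V hU hV hUne hVne
  obtain ⟨u, huU, hu⟩ := hP.inter_open_nonempty U hU hUne
  obtain ⟨v, hvV, w, hw, hw0⟩ := hQ.inter_open_nonempty V hV hVne
  have h1 : Tendsto (fun n => u + w n) atTop (𝓝 u) := by simpa using hw0.const_add u
  have h2 : Tendsto (fun n : ℕ => (⇑B)^[n] (u + w n)) atTop (𝓝 v) := by
    simpa [iterate_map_add, hw] using Tendsto.add_const (M := lp (fun _ : ℤ => X) 1) v hu
  obtain ⟨n, hnU, hnV⟩ :=
    ((h1.eventually (hU.mem_nhds huU)).and (h2.eventually (hV.mem_nhds hvV))).exists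
  exact ⟨n, _, ⟨_, hnU, rfl⟩, hnV⟩

theorem dense_summableOrbits_of_dense_periodicPoints
    (hB : ∀ (x : lp (fun _ : ℤ => X) 1) (n : ℤ), (B x : ℤ → X) n = T ((x : ℤ → X) (n + 1)))
    (hper : Dense {x : lp (fun _ : ℤ => X) 1 | ∃ d : ℕ, 1 ≤ d ∧ (⇑B)^[d] x = x}) :
    Dense {x | ∃ y, IsSummableOrbit T y ∧ y 0 = x} := by
  rw [Metric.dense_iff]
  intro z ε hε
  obtain ⟨x, hxz, d, hd, hx⟩ := Metric.dense_iff.1 hper (lp.single 1 0 z) ε hε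
  refine ⟨x 0, ?_, exists_isSummableOrbit_of_periodic hd (memℓp_one_iff.1 (lp.memℓp x))
    fun n => ?_⟩
  · rw [mem_ball_iff_norm] at hxz ⊢
    refine lt_of_le_of_lt ?_ hxz
    have := lp.norm_apply_le_norm one_ne_zero (x - lp.single 1 0 z) 0
    rwa [lp.coeFn_sub, Pi.sub_apply, lp.single_apply_self] at this
  · rw [← bilateralShift_iterate_apply hB, hx]

end BilateralShift

/-- the bilateral shift `B_T` is chaotic on `ℓ¹(X,ℤ)` iff `T` satisfies the
Frequent Hypercyclicity Criterion with `X₀ = Y₀`: a dense set `X₀` and `S : X₀ → X₀` with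
`∑ ‖T^n x‖ < ∞`, `∑ ‖S^n x‖ < ∞` and `TSx = x` for all `x ∈ X₀`. -/
theorem stmt_16 {X : Type*} [NormedAddCommGroup X] [NormedSpace ℝ X] [CompleteSpace X]
    [TopologicalSpace.SeparableSpace X] (T : X →L[ℝ] X) :
    ∀ B : lp (fun _ : ℤ => X) 1 →L[ℝ] lp (fun _ : ℤ => X) 1,
      (∀ (x : lp (fun _ : ℤ => X) 1) (n : ℤ),
        (B x : ℤ → X) n = T ((x : ℤ → X) (n + 1))) →
      (Chaotic ⇑B ↔
        ∃ X₀ : Set X, Dense X₀ ∧ ∃ S : X → X, (∀ x ∈ X₀, S x ∈ X₀) ∧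
          ∀ x ∈ X₀,
            Summable (fun n : ℕ => ‖(⇑T)^[n + 1] x‖)
            ∧ Summable (fun n : ℕ => ‖S^[n + 1] x‖)
            ∧ T (S x) = x) := by
  intro B hB
  constructor
  · rintro ⟨-, hper⟩
    obtain ⟨S, hS⟩ := exists_rightInverse_of_summableOrbits T
    refine ⟨_, dense_summableOrbits_of_dense_periodicPoints hB hper, S, fun x hx => (hS x hx).1,
      fun x hx => ⟨?_, (summable_nat_add_iff 1).2 (hS x hx).2.1, (hS x hx).2.2⟩⟩
    obtain ⟨y, hy, rfl⟩ := hx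
    have hT (n : ℕ) : (⇑T)^[n] (y 0) = y (-n) := by simpa using hy.iterate n (-n)
    simp only [hT]
    exact hy.summable.comp_injective (i := fun n : ℕ => -((n + 1 : ℕ) : ℤ))
      fun a b h => by simpa using h
  · rintro ⟨X₀, hX₀, S, hS, h⟩
    have hD : Dense {x | ∃ y, IsSummableOrbit T y ∧ y 0 = x} := hX₀.mono fun x hx =>
      exists_isSummableOrbit hS (fun x hx => (h x hx).2.2) hx (h x hx).1 (h x hx).2.1
    have : SecondCountableTopology (lp (fun _ : ℤ => X) 1) :=
      UniformSpace.secondCountable_of_separable _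
    exact ⟨(topologicallyTransitive_of_summableOrbits hB hD).hypercyclic B.continuous,
      dense_periodicPoints_of_summableOrbits hB hD⟩
end
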